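/- arXiv:1508.03816 — 2 statements merged into one kernel-verified Lean document; each statement's English description precedes it below -/
import Mathlib

section
/- Let T ⊂ ℙ²(ℝ) be a set of exactly 8 points such that no 4 points of T lie on a line and no 7 points of T lie on a conic. Then the space I₆(2T) of sextic forms singular at every point of T has dimension 4, and the space I₃(T)², spanned by all products of two cubic forms vanishing on T, has dimension 3. -/
open MvPolynomial

noncomputable section

/-- The real projective plane, as lines through the origin of `ℝ³`. -/
abbrev P2 := Projectivization ℝ (Fin 3 → ℝ)

/-- A polynomial is psd if it takes only nonnegative values on `ℝ³`. -/
def Psd (g : MvPolynomial (Fin 3) ℝ) : Prop := ∀ u : Fin 3 → ℝ, 0 ≤ eval u g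

/-- A polynomial is sos if it is a finite sum of squares. -/
def Sos (g : MvPolynomial (Fin 3) ℝ) : Prop :=
  ∃ (n : ℕ) (h : Fin n → MvPolynomial (Fin 3) ℝ), g = ∑ i, (h i) ^ 2

/-- A form vanishes at a point of `ℙ²(ℝ)` if it vanishes at a representative vector. -/
def VanishAt (g : MvPolynomial (Fin 3) ℝ) (P : P2) : Prop := eval P.rep g = 0

/-- A form is singular at a point of `ℙ²(ℝ)` if it and all its first partial
derivatives vanish at a representative vector. -/
def SingAt (g : MvPolynomial (Fin 3) ℝ) (P : P2) : Prop :=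
  eval P.rep g = 0 ∧ ∀ i, eval P.rep (pderiv i g) = 0

/-- `I_d(T)`: the space of degree-`d` forms vanishing at every point of `T`. -/
def Isub (d : ℕ) (T : Set P2) : Submodule ℝ (MvPolynomial (Fin 3) ℝ) :=
  (homogeneousSubmodule (Fin 3) ℝ d) ⊓
  { carrier := {f | ∀ P ∈ T, VanishAt f P}
    zero_mem' := by intro P _; simp [VanishAt]
    add_mem' := by
      intro a b ha hb P hP
      have h1 := ha P hP; have h2 := hb P hP
      unfold VanishAt at *; simp [h1, h2]
    smul_mem' := by
      intro c f hf P hP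
      have h1 := hf P hP
      unfold VanishAt at *; simp [smul_eq_C_mul, h1] }

/-- `I_d(2T)`: the space of degree-`d` forms singular at every point of `T`. -/
def Isub2 (d : ℕ) (T : Set P2) : Submodule ℝ (MvPolynomial (Fin 3) ℝ) :=
  (homogeneousSubmodule (Fin 3) ℝ d) ⊓
  { carrier := {f | ∀ P ∈ T, SingAt f P}
    zero_mem' := by intro P _; constructor <;> simp [SingAt]
    add_mem' := by
      intro a b ha hb P hP
      obtain ⟨h1, h2⟩ := ha P hP; obtain ⟨h3, h4⟩ := hb P hP
      exact ⟨by simp [h1, h3], fun i => by simp [h2 i, h4 i]⟩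
    smul_mem' := by
      intro c f hf P hP
      obtain ⟨h1, h2⟩ := hf P hP
      refine ⟨by simp [smul_eq_C_mul, h1], fun i => ?_⟩
      have := h2 i
      simp [smul_eq_C_mul, this] }

/-- `I₃(T)²`: the span of products of two cubics vanishing on `T`. -/
def IsqCubic (T : Set P2) : Submodule ℝ (MvPolynomial (Fin 3) ℝ) :=
  Submodule.span ℝ {h | ∃ f₁ ∈ Isub 3 T, ∃ f₂ ∈ Isub 3 T, h = f₁ * f₂}

/-- No 4 points of `T` on a line, no 7 on a conic. -/
def GenPos (T : Set P2) : Prop :=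
  (∀ l : MvPolynomial (Fin 3) ℝ, l ≠ 0 → l.IsHomogeneous 1 →
    {P ∈ T | VanishAt l P}.encard ≤ 3) ∧
  (∀ c : MvPolynomial (Fin 3) ℝ, c ≠ 0 → c.IsHomogeneous 2 →
    {P ∈ T | VanishAt c P}.encard ≤ 6)

/-- The real projective zero set of `g`. -/
def VR (g : MvPolynomial (Fin 3) ℝ) : Set P2 := {P | VanishAt g P}



/-! ### Homogeneous forms -/

abbrev MP := MvPolynomial (Fin 3) ℝ

abbrev Sd (d : ℕ) : Submodule ℝ MP := homogeneousSubmodule (Fin 3) ℝ d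

instance sd_fin (d : ℕ) : FiniteDimensional ℝ (Sd d) :=
  Module.Finite.iff_fg.mpr (homogeneousSubmodule_fg _ _ d)

lemma finrank_sd (d : ℕ) : Module.finrank ℝ (Sd d) = (d + 2).choose d := by
  have h1 : Sd d = AddMonoidAlgebra.supported _ ℝ {e : Fin 3 →₀ ℕ | e.degree = d} :=
    homogeneousSubmodule_eq_finsupp_supported _ _ d
  have h2 : {e : Fin 3 →₀ ℕ | e.degree = d} =
      ((Finset.univ : Finset (Fin 3)).finsuppAntidiag d : Set (Fin 3 →₀ ℕ)) := by
    ext e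
    simp [Finsupp.degree_eq_sum]
  rw [h2] at h1
  rw [h1, (AddMonoidAlgebra.supportedEquivFinsupp (R := ℝ) (S := ℝ) _).finrank_eq]
  have : ((d+2).choose d) = ((Finset.univ : Finset (Fin 3)).finsuppAntidiag d).card := by
    rw [Finset.card_finsuppAntidiag_nat_eq_choose]
    simp
    congr 1
    omega
  rw [this, Module.finrank_finsupp_self]
  simp

/-- Substitution `X i ↦ X i * t`. -/
def dilate : MP →ₐ[ℝ] Polynomial MP :=
  aeval (fun i => Polynomial.C (X i) * Polynomial.X)

lemma dilate_homog {p : MP} {n : ℕ} (hp : p.IsHomogeneous n) :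
    dilate p = Polynomial.C p * Polynomial.X ^ n := by
  have key : ∀ d : Fin 3 →₀ ℕ, ∀ c : ℝ, dilate (monomial d c) =
      Polynomial.C (monomial d c) * Polynomial.X ^ d.degree := by
    intro d c
    have hm : (monomial d c : MP) = C c * (X 0 ^ d 0 * X 1 ^ d 1 * X 2 ^ d 2) := by
      rw [monomial_eq, Finsupp.prod_fintype _ _ (by simp), Fin.prod_univ_three]
    rw [hm, Finsupp.degree_eq_sum, Fin.sum_univ_three]
    have hc : dilate (C c) = Polynomial.C (C c) := by
      rw [dilate, aeval_C]; rfl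
    have hX : ∀ i, dilate (X i) = Polynomial.C (X i) * Polynomial.X := by
      intro i; rw [dilate, aeval_X]
    simp only [map_mul, map_pow, hc, hX]
    ring
  conv_lhs => rw [p.as_sum]
  conv_rhs => rw [p.as_sum]
  rw [map_sum, map_sum, Finset.sum_mul]
  refine Finset.sum_congr rfl fun d hd => ?_
  have hd' : d.degree = n := by
    rw [hp.degree_eq_sum_deg_support hd, Finsupp.degree_apply]
  rw [key, hd']

lemma dilate_eq (p : MP) : dilate p = ∑ k ∈ Finset.range (p.totalDegree + 1),
    Polynomial.C (homogeneousComponent k p) * Polynomial.X ^ k := by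
  conv_lhs => rw [← sum_homogeneousComponent p]
  rw [map_sum]
  exact Finset.sum_congr rfl fun k _ => dilate_homog (homogeneousComponent_isHomogeneous k p)

lemma dilate_coeff (p : MP) (k : ℕ) : (dilate p).coeff k = homogeneousComponent k p := by
  rw [dilate_eq, Polynomial.finsetSum_coeff]
  simp only [Polynomial.coeff_C_mul_X_pow]
  rw [Finset.sum_ite_eq]
  split_ifs with h
  · rfl
  · rw [homogeneousComponent_eq_zero]
    simp at h
    omega

lemma dilate_ne {p : MP} (hp : p ≠ 0) : dilate p ≠ 0 := by
  intro h
  apply hp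
  rw [← sum_homogeneousComponent p]
  refine Finset.sum_eq_zero fun k _ => ?_
  rw [← dilate_coeff, h, Polynomial.coeff_zero]

/-- Factors of nonzero forms are forms. -/
lemma homog_factor {p q : MP} {n : ℕ} (h : (p * q).IsHomogeneous n) (h0 : p * q ≠ 0) :
    ∃ a b, a + b = n ∧ p.IsHomogeneous a ∧ q.IsHomogeneous b := by
  have hp := left_ne_zero_of_mul h0
  have hq := right_ne_zero_of_mul h0
  have hP := dilate_ne hp
  have hQ := dilate_ne hq
  have e := dilate_homog h
  rw [map_mul] at e
  have e1 : (dilate p).natDegree + (dilate q).natDegree = n := by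
    rw [← Polynomial.natDegree_mul hP hQ, e, Polynomial.natDegree_C_mul_X_pow _ _ h0]
  have e2 : (dilate p).natTrailingDegree + (dilate q).natTrailingDegree = n := by
    rw [← Polynomial.natTrailingDegree_mul hP hQ, e, Polynomial.C_mul_X_pow_eq_monomial,
      Polynomial.natTrailingDegree_monomial h0]
  have l1 := Polynomial.natTrailingDegree_le_natDegree (dilate p)
  have l2 := Polynomial.natTrailingDegree_le_natDegree (dilate q)
  have key : ∀ r : MP, (dilate r).natTrailingDegree = (dilate r).natDegree →
      r.IsHomogeneous (dilate r).natDegree := by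
    intro r hr
    have : r = homogeneousComponent (dilate r).natDegree r := by
      conv_lhs => rw [← sum_homogeneousComponent r]
      by_cases hm : (dilate r).natDegree ∈ Finset.range (r.totalDegree + 1)
      · rw [Finset.sum_eq_single_of_mem _ hm]
        intro k _ hk
        rw [← dilate_coeff]
        rcases lt_or_gt_of_ne hk with hk | hk
        · exact Polynomial.coeff_eq_zero_of_lt_natTrailingDegree (hr ▸ hk)
        · exact Polynomial.coeff_eq_zero_of_natDegree_lt hk
      · have hz : homogeneousComponent (dilate r).natDegree r = 0 := by
          apply homogeneousComponent_eq_zero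
          simp at hm; omega
        rw [hz]
        refine Finset.sum_eq_zero fun k hk' => ?_
        have hk : k ≠ (dilate r).natDegree := fun h => hm (h ▸ hk')
        rw [← dilate_coeff]
        rcases lt_or_gt_of_ne hk with hk | hk
        · exact Polynomial.coeff_eq_zero_of_lt_natTrailingDegree (hr ▸ hk)
        · exact Polynomial.coeff_eq_zero_of_natDegree_lt hk
    have h2 := homogeneousComponent_isHomogeneous (dilate r).natDegree r
    rwa [← this] at h2
  exact ⟨_, _, e1, key p (by omega), key q (by omega)⟩

lemma finrank_inf_ker {M N : Type*} [AddCommGroup M] [Module ℝ M] [AddCommGroup N] [Module ℝ N]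
    (S : Submodule ℝ M) [FiniteDimensional ℝ S] (L : M →ₗ[ℝ] N) :
    Module.finrank ℝ (S.map L) + Module.finrank ℝ (S ⊓ LinearMap.ker L : Submodule ℝ M) =
      Module.finrank ℝ S := by
  have h := LinearMap.finrank_range_add_finrank_ker (L.domRestrict S)
  have h1 : LinearMap.range (L.domRestrict S) = S.map L := LinearMap.range_domRestrict S L
  have h2 : LinearMap.ker (L.domRestrict S) = (S ⊓ LinearMap.ker L).comap S.subtype := by
    ext x; simp
  rw [h1, h2] at h
  rw [← h]
  congr 1
  exact (LinearEquiv.finrank_eq (Submodule.comapSubtypeEquivOfLe inf_le_left)).symm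

/-! ### Vectors, lines, general position -/

abbrev V3 := Fin 3 → ℝ

def dt (a b : V3) : ℝ := a 0 * b 0 + a 1 * b 1 + a 2 * b 2

def cr (a b : V3) : V3 :=
  ![a 1 * b 2 - a 2 * b 1, a 2 * b 0 - a 0 * b 2, a 0 * b 1 - a 1 * b 0]

def lin (w : V3) : MP := C (w 0) * X 0 + C (w 1) * X 1 + C (w 2) * X 2

@[simp] lemma eval_lin (w x : V3) : eval x (lin w) = dt w x := by
  simp [lin, dt]

lemma lin_homog (w : V3) : (lin w).IsHomogeneous 1 :=
  ((isHomogeneous_C_mul_X _ _).add (isHomogeneous_C_mul_X _ _)).add (isHomogeneous_C_mul_X _ _)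

lemma dt_self_pos {w : V3} (h : w ≠ 0) : 0 < dt w w := by
  have : 0 ≤ dt w w := by
    unfold dt
    nlinarith [mul_self_nonneg (w 0), mul_self_nonneg (w 1), mul_self_nonneg (w 2)]
  rcases this.lt_or_eq with h1 | h1
  · exact h1
  · exfalso
    apply h
    unfold dt at h1
    ext i
    fin_cases i <;> simp <;> nlinarith [mul_self_nonneg (w 0), mul_self_nonneg (w 1),
      mul_self_nonneg (w 2)]

lemma lin_ne {w : V3} (h : w ≠ 0) : lin w ≠ 0 := by
  intro h0
  have := eval_lin w w
  rw [h0, map_zero] at this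
  exact absurd this (dt_self_pos h).ne

structure Gen (v : Fin 8 → V3) : Prop where
  cross : ∀ i j, i ≠ j → cr (v i) (v j) ≠ 0
  line : ∀ l ∈ Sd 1, l ≠ 0 → ∀ s : Finset (Fin 8), (∀ i ∈ s, eval (v i) l = 0) → s.card ≤ 3
  conic : ∀ c ∈ Sd 2, c ≠ 0 → ∀ s : Finset (Fin 8), (∀ i ∈ s, eval (v i) c = 0) → s.card ≤ 6

def det3 (a b c : V3) : ℝ := dt (cr a b) c

lemma det3_def (a b c : V3) : det3 a b c = (a 1 * b 2 - a 2 * b 1) * c 0 +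
    (a 2 * b 0 - a 0 * b 2) * c 1 + (a 0 * b 1 - a 1 * b 0) * c 2 := by
  simp [det3, dt, cr]

lemma det3_rot (a b c : V3) : det3 b c a = det3 a b c := by
  simp only [det3_def]; ring

lemma det3_swap (a b c : V3) : det3 b a c = - det3 a b c := by
  simp only [det3_def]; ring

lemma det3_self1 (a b : V3) : det3 a b a = 0 := by
  simp only [det3_def]; ring

lemma det3_self2 (a b : V3) : det3 a b b = 0 := by
  simp only [det3_def]; ring

/-- Evaluation at a family of points. -/
def evL {n : ℕ} (x : Fin n → V3) : MP →ₗ[ℝ] (Fin n → ℝ) :=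
  LinearMap.pi fun i => (aeval (x i) : MP →ₐ[ℝ] ℝ).toLinearMap

@[simp] lemma evL_apply {n : ℕ} (x : Fin n → V3) (F : MP) (i : Fin n) :
    evL x F i = eval (x i) F := by
  simp [evL, aeval_eq_eval]

lemma mem_ker_evL {n : ℕ} (x : Fin n → V3) (F : MP) :
    F ∈ LinearMap.ker (evL x) ↔ ∀ i, eval (x i) F = 0 := by
  rw [LinearMap.mem_ker, funext_iff]; simp

lemma finrank_ge {n : ℕ} (d : ℕ) (x : Fin n → V3) :
    Module.finrank ℝ (Sd d) ≤
      Module.finrank ℝ (Sd d ⊓ LinearMap.ker (evL x) : Submodule ℝ MP) + n := by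
  have h := finrank_inf_ker (Sd d) (evL x)
  have h2 : Module.finrank ℝ ((Sd d).map (evL x)) ≤ n := by
    simpa using Submodule.finrank_le ((Sd d).map (evL x))
  omega

lemma finrank_sep {n : ℕ} (d : ℕ) (x : Fin n → V3)
    (h : ∀ i, ∃ F ∈ Sd d, eval (x i) F ≠ 0 ∧ ∀ j, j ≠ i → eval (x j) F = 0) :
    Module.finrank ℝ (Sd d ⊓ LinearMap.ker (evL x) : Submodule ℝ MP) + n =
      Module.finrank ℝ (Sd d) := by
  have h1 := finrank_inf_ker (Sd d) (evL x)
  have h2 : (Sd d).map (evL x) = ⊤ := by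
    rw [eq_top_iff]
    intro y _
    rw [pi_eq_sum_univ' y]
    refine Submodule.sum_mem _ fun i _ => ?_
    refine Submodule.smul_mem _ _ ?_
    obtain ⟨F, hF, h3, h4⟩ := h i
    refine ⟨(eval (x i) F)⁻¹ • F, Submodule.smul_mem _ _ hF, ?_⟩
    ext j
    by_cases hj : j = i
    · subst hj
      simp [smul_eval, h3]
    · simp [smul_eval, h4 j hj, Ne.symm hj]
  rw [h2] at h1
  simp at h1
  omega

lemma exists_conic (x : Fin 5 → V3) : ∃ c ∈ Sd 2, c ≠ 0 ∧ ∀ i, eval (x i) c = 0 := by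
  have h := finrank_ge 2 x
  rw [finrank_sd] at h
  have h6 : (2 + 2).choose 2 = 6 := by decide
  have h1 : 0 < Module.finrank ℝ (Sd 2 ⊓ LinearMap.ker (evL x) : Submodule ℝ MP) := by omega
  have : (Sd 2 ⊓ LinearMap.ker (evL x) : Submodule ℝ MP) ≠ ⊥ := by
    intro h0
    rw [h0] at h1
    simp at h1
  obtain ⟨c, hc, h0⟩ := Submodule.exists_mem_ne_zero_of_ne_bot this
  exact ⟨c, hc.1, h0, (mem_ker_evL x c).1 hc.2⟩

section
variable {v : Fin 8 → V3}

lemma Gen.no4 (hv : Gen v) {i j k l : Fin 8} (hij : i ≠ j) (hik : i ≠ k) (hil : i ≠ l)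
    (hjk : j ≠ k) (hjl : j ≠ l) (hkl : k ≠ l) (h1 : det3 (v i) (v j) (v k) = 0)
    (h2 : det3 (v i) (v j) (v l) = 0) : False := by
  have h := hv.line (lin (cr (v i) (v j))) (lin_homog _) (lin_ne (hv.cross i j hij)) {i, j, k, l}
    (by
      intro m hm
      simp only [Finset.mem_insert, Finset.mem_singleton] at hm
      rw [eval_lin]
      rcases hm with rfl | rfl | rfl | rfl
      · exact det3_self1 _ _
      · exact det3_self2 _ _
      · exact h1
      · exact h2)
  rw [Finset.card_eq_of_equiv_fin (n := 4)] at h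
  · omega
  · apply Finset.equivFinOfCardEq
    simp [*]

lemma Gen.conic_sep (hv : Gen v) {A b c d e : Fin 8} (hAb : A ≠ b) (hAc : A ≠ c) (hAd : A ≠ d)
    (hAe : A ≠ e) (hbc : b ≠ c) (hbd : b ≠ d) (hbe : b ≠ e) (hcd : c ≠ d) (hce : c ≠ e)
    (hde : d ≠ e) : ∃ F ∈ Sd 2, eval (v A) F ≠ 0 ∧ eval (v b) F = 0 ∧ eval (v c) F = 0 ∧
      eval (v d) F = 0 ∧ eval (v e) F = 0 := by
  have mk : ∀ {b c d e : Fin 8}, det3 (v b) (v c) (v A) ≠ 0 → det3 (v d) (v e) (v A) ≠ 0 →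
      ∃ F ∈ Sd 2, eval (v A) F ≠ 0 ∧ eval (v b) F = 0 ∧ eval (v c) F = 0 ∧
      eval (v d) F = 0 ∧ eval (v e) F = 0 := by
    intro b c d e h1 h2
    refine ⟨lin (cr (v b) (v c)) * lin (cr (v d) (v e)), (lin_homog _).mul (lin_homog _), ?_, ?_⟩
    · rw [map_mul, eval_lin, eval_lin]
      exact mul_ne_zero h1 h2
    · simp only [map_mul, eval_lin]
      change det3 _ _ _ * det3 _ _ _ = 0 ∧ det3 _ _ _ * det3 _ _ _ = 0 ∧
        det3 _ _ _ * det3 _ _ _ = 0 ∧ det3 _ _ _ * det3 _ _ _ = 0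
      simp [det3_self1, det3_self2]
  by_cases h1 : det3 (v b) (v c) (v A) = 0
  · have h13 : det3 (v b) (v d) (v A) ≠ 0 := by
      intro h
      refine hv.no4 hAb hAc hAd hbc hbd hcd ?_ ?_
      · rw [← det3_rot]; exact h1
      · rw [← det3_rot]; exact h
    have h24 : det3 (v c) (v e) (v A) ≠ 0 := by
      intro h
      refine hv.no4 hAc hAb hAe hbc.symm hce hbe ?_ ?_
      · rw [← det3_rot, det3_swap, h1, neg_zero]
      · rw [← det3_rot]; exact h
    obtain ⟨F, hF, a1, a2, a3, a4, a5⟩ := mk h13 h24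
    exact ⟨F, hF, a1, a2, a4, a3, a5⟩
  by_cases h2 : det3 (v d) (v e) (v A) = 0
  · have h13 : det3 (v b) (v d) (v A) ≠ 0 := by
      intro h
      refine hv.no4 hAd hAe hAb hde hbd.symm hbe.symm ?_ ?_
      · rw [← det3_rot]; exact h2
      · rw [← det3_rot, det3_swap, h, neg_zero]
    have h24 : det3 (v c) (v e) (v A) ≠ 0 := by
      intro h
      refine hv.no4 hAe hAd hAc hde.symm hce.symm hcd.symm ?_ ?_
      · rw [← det3_rot, det3_swap, h2, neg_zero]
      · rw [← det3_rot, det3_swap, h, neg_zero]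
    obtain ⟨F, hF, a1, a2, a3, a4, a5⟩ := mk h13 h24
    exact ⟨F, hF, a1, a2, a4, a3, a5⟩
  exact mk h1 h2

/-- There is at most one conic through five points of the configuration. -/
lemma Gen.conic_unique (hv : Gen v) (a : Fin 5 → Fin 8) (ha : Function.Injective a) {c c' : MP}
    (hc : c ∈ Sd 2) (hc' : c' ∈ Sd 2) (h : ∀ i, eval (v (a i)) c = 0)
    (h' : ∀ i, eval (v (a i)) c' = 0) (h0 : c ≠ 0) : ∃ r : ℝ, c' = r • c := by
  have hn : ∀ i j, i ≠ j → a i ≠ a j := fun i j hij h => hij (ha h)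
  have hf := finrank_sep 2 (fun i => v (a i)) (by
    intro i
    have key : ∀ i0 i1 i2 i3 i4 : Fin 5, i0 ≠ i1 → i0 ≠ i2 → i0 ≠ i3 → i0 ≠ i4 → i1 ≠ i2 →
        i1 ≠ i3 → i1 ≠ i4 → i2 ≠ i3 → i2 ≠ i4 → i3 ≠ i4 → ∃ F ∈ Sd 2, eval (v (a i0)) F ≠ 0 ∧
        ∀ j, j ≠ i0 → eval (v (a j)) F = 0 := by
      intro i0 i1 i2 i3 i4 h1 h2 h3 h4 h5 h6 h7 h8 h9 h10
      obtain ⟨F, hF, a1, a2, a3, a4, a5⟩ := hv.conic_sep (hn _ _ h1) (hn _ _ h2) (hn _ _ h3)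
        (hn _ _ h4) (hn _ _ h5) (hn _ _ h6) (hn _ _ h7) (hn _ _ h8) (hn _ _ h9) (hn _ _ h10)
      refine ⟨F, hF, a1, fun j hj => ?_⟩
      have : j = i1 ∨ j = i2 ∨ j = i3 ∨ j = i4 := by omega
      rcases this with rfl | rfl | rfl | rfl <;> assumption
    exact key i (i + 1) (i + 2) (i + 3) (i + 4) (by omega) (by omega) (by omega) (by omega)
      (by omega) (by omega) (by omega) (by omega) (by omega) (by omega))
  rw [finrank_sd] at hf
  have h6 : (2 + 2).choose 2 = 6 := by decide
  have h1 : Module.finrank ℝ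
      (Sd 2 ⊓ LinearMap.ker (evL fun i => v (a i)) : Submodule ℝ MP) = 1 := by omega
  have hcm : c ∈ (Sd 2 ⊓ LinearMap.ker (evL fun i => v (a i)) : Submodule ℝ MP) :=
    ⟨hc, (mem_ker_evL _ _).2 h⟩
  have hcm' : c' ∈ (Sd 2 ⊓ LinearMap.ker (evL fun i => v (a i)) : Submodule ℝ MP) :=
    ⟨hc', (mem_ker_evL _ _).2 h'⟩
  obtain ⟨r, hr⟩ := (finrank_eq_one_iff_of_nonzero' (⟨c, hcm⟩ : (Sd 2 ⊓ LinearMap.ker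
    (evL fun i => v (a i)) : Submodule ℝ MP)) (by simpa using h0)).1 h1 ⟨c', hcm'⟩
  exact ⟨r, by simpa using (congrArg Subtype.val hr).symm⟩

lemma Gen.cubic_sep (hv : Gen v) (P : Fin 8) :
    ∃ h ∈ Sd 3, eval (v P) h ≠ 0 ∧ ∀ j, j ≠ P → eval (v j) h = 0 := by
  obtain ⟨q, hq⟩ : ∃ q : Fin 8, q ≠ P := ⟨P + 1, by omega⟩
  obtain ⟨r, hrP, hrq, hr⟩ : ∃ r : Fin 8, r ≠ P ∧ r ≠ q ∧
      ∀ k, k ≠ P → k ≠ q → k ≠ r → det3 (v P) (v q) (v k) ≠ 0 := by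
    by_cases hex : ∃ r : Fin 8, r ≠ P ∧ r ≠ q ∧ det3 (v P) (v q) (v r) = 0
    · obtain ⟨r, h1, h2, h3⟩ := hex
      exact ⟨r, h1, h2, fun k hk1 hk2 hk3 hk => hv.no4 hq.symm h1.symm hk1.symm h2.symm
        hk2.symm hk3.symm h3 hk⟩
    · push Not at hex
      obtain ⟨r, h1, h2⟩ : ∃ r : Fin 8, r ≠ P ∧ r ≠ q := by
        clear hex hq
        revert P q; decide
      exact ⟨r, h1, h2, fun k hk1 hk2 _ => hex k hk1 hk2⟩
  have hcard : ((Finset.univ : Finset (Fin 8)) \ {P, q, r}).card = 5 := by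
    rw [Finset.card_sdiff_of_subset (Finset.subset_univ _)]
    rw [Finset.card_eq_three.2 ⟨P, q, r, hq.symm, hrP.symm, hrq.symm, rfl⟩]
    simp
  let e := Finset.orderEmbOfFin _ hcard
  have hemem : ∀ k, e k ≠ P ∧ e k ≠ q ∧ e k ≠ r := by
    intro k
    have := Finset.orderEmbOfFin_mem _ hcard k
    rw [Finset.mem_sdiff] at this
    simpa using this.2
  have hsurj : ∀ j, j ≠ P → j ≠ q → j ≠ r → ∃ k, e k = j := by
    intro j h1 h2 h3
    have : j ∈ Set.range (Finset.orderEmbOfFin _ hcard) := by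
      rw [Finset.range_orderEmbOfFin]; simp [h1, h2, h3]
    exact this
  have einj : ∀ i j, i ≠ j → e i ≠ e j := fun i j h h' => h (e.injective h')
  obtain ⟨c, hc, hc0, hcv⟩ := exists_conic ![v r, v (e 0), v (e 1), v (e 2), v (e 3)]
  obtain ⟨c', hc', hc0', hcv'⟩ := exists_conic ![v r, v (e 0), v (e 1), v (e 2), v (e 4)]
  simp only [Fin.forall_fin_succ, Fin.isValue] at hcv hcv'
  simp at hcv hcv'
  obtain ⟨c1, c2, c3, c4, c5⟩ := hcv
  obtain ⟨c1', c2', c3', c4', c5'⟩ := hcv'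
  have mk : ∀ (c : MP) (k : Fin 5), c ∈ Sd 2 → eval (v P) c ≠ 0 → eval (v r) c = 0 →
      (∀ j, j ≠ k → eval (v (e j)) c = 0) →
      ∃ h ∈ Sd 3, eval (v P) h ≠ 0 ∧ ∀ j, j ≠ P → eval (v j) h = 0 := by
    intro c k hc hcP hcr hce
    refine ⟨c * lin (cr (v q) (v (e k))), hc.mul (lin_homog _), ?_, ?_⟩
    · rw [map_mul, eval_lin]
      refine mul_ne_zero hcP ?_
      change det3 _ _ _ ≠ 0
      rw [det3_rot]
      exact hr _ (hemem k).1 (hemem k).2.1 (hemem k).2.2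
    · intro j hj
      rw [map_mul, eval_lin]
      change _ * det3 _ _ _ = 0
      by_cases hjq : j = q
      · rw [hjq, det3_self1, mul_zero]
      by_cases hjr : j = r
      · rw [hjr, hcr, zero_mul]
      obtain ⟨i, rfl⟩ := hsurj j hj hjq hjr
      by_cases hik : i = k
      · rw [hik, det3_self2, mul_zero]
      · rw [hce i hik, zero_mul]
  by_cases hcP : eval (v P) c = 0
  · by_cases hcP' : eval (v P) c' = 0
    · exfalso
      obtain ⟨s, hs⟩ := hv.conic_unique ![P, r, e 0, e 1, e 2] (by
          intro i j hij
          have h0 := hemem 0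
          have h1 := hemem 1
          have h2 := hemem 2
          have h01 := einj 0 1 (by decide)
          have h02 := einj 0 2 (by decide)
          have h12 := einj 1 2 (by decide)
          clear_value e
          fin_cases i <;> fin_cases j <;> simp at hij ⊢ <;> omega) hc hc'
        (by intro i; fin_cases i <;> simp [*]) (by intro i; fin_cases i <;> simp [*]) hc0
      have hs0 : s ≠ 0 := by
        rintro rfl
        exact hc0' (by simpa using hs)
      have h7 := hv.conic c hc hc0 (Finset.univ.erase q) (by
        intro j hj
        have hjq : j ≠ q := by simpa using hj
        by_cases hjP : j = P
        · rw [hjP, hcP]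
        by_cases hjr : j = r
        · rw [hjr, c1]
        obtain ⟨i, rfl⟩ := hsurj j hjP hjq hjr
        by_cases hi : i = 4
        · subst hi
          rw [hs, smul_eval] at c5'
          exact (mul_eq_zero.1 c5').resolve_left hs0
        · have : i = 0 ∨ i = 1 ∨ i = 2 ∨ i = 3 := by omega
          rcases this with rfl | rfl | rfl | rfl <;> assumption)
      rw [Finset.card_erase_of_mem (Finset.mem_univ _)] at h7
      simp at h7
    · refine mk c' 3 hc' hcP' c1' fun j hj => ?_
      have : j = 0 ∨ j = 1 ∨ j = 2 ∨ j = 4 := by omega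
      rcases this with rfl | rfl | rfl | rfl <;> assumption
  · refine mk c 4 hc hcP c1 fun j hj => ?_
    have : j = 0 ∨ j = 1 ∨ j = 2 ∨ j = 3 := by omega
    rcases this with rfl | rfl | rfl | rfl <;> assumption

lemma Gen.finrank3 (hv : Gen v) :
    Module.finrank ℝ (Sd 3 ⊓ LinearMap.ker (evL v) : Submodule ℝ MP) = 2 := by
  have h := finrank_sep 3 v hv.cubic_sep
  rw [finrank_sd] at h
  have h6 : (3 + 2).choose 3 = 10 := by decide
  omega

end

/-! ### Coprimality and the Koszul count -/

lemma exists_lin (a b : V3) (h : cr a b ≠ 0) : ∃ l ∈ Sd 1, eval a l = 0 ∧ eval b l ≠ 0 := by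
  refine ⟨lin (cr a (cr a b)), lin_homog _, ?_, ?_⟩
  · rw [eval_lin]; exact det3_self1 _ _
  · rw [eval_lin]
    have h1 := dt_self_pos h
    have : dt (cr a (cr a b)) b = - dt (cr a b) (cr a b) := by
      simp [dt, cr]; ring
    rw [this]
    linarith

def Indep (f g : MP) : Prop := ∀ α β : ℝ, α • f + β • g = 0 → α = 0 ∧ β = 0

lemma Indep.ne_left {f g : MP} (h : Indep f g) : f ≠ 0 := by
  rintro rfl
  have := (h 1 0 (by simp)).1
  norm_num at this

lemma Indep.ne_right {f g : MP} (h : Indep f g) : g ≠ 0 := by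
  rintro rfl
  have := (h 0 1 (by simp)).2
  norm_num at this

lemma homog_zero {p : MP} (h : p.IsHomogeneous 0) : ∃ r : ℝ, p = C r := by
  rw [← totalDegree_zero_iff_isHomogeneous, totalDegree_eq_zero_iff_eq_C] at h
  exact ⟨_, h⟩

section
variable {v : Fin 8 → V3}

lemma Gen.line_unique (hv : Gen v) {i j : Fin 8} (hij : i ≠ j) {c c' : MP}
    (hc : c ∈ Sd 1) (hc' : c' ∈ Sd 1) (h : eval (v i) c = 0 ∧ eval (v j) c = 0)
    (h' : eval (v i) c' = 0 ∧ eval (v j) c' = 0) (h0 : c ≠ 0) : ∃ r : ℝ, c' = r • c := by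
  have hf := finrank_sep 1 ![v i, v j] (by
    intro k
    fin_cases k
    · obtain ⟨l, hl, h1, h2⟩ := exists_lin _ _ (hv.cross j i hij.symm)
      refine ⟨l, hl, by simpa using h2, fun m hm => ?_⟩
      have : m = 1 := by fin_cases m <;> simp at hm ⊢
      subst this; simpa using h1
    · obtain ⟨l, hl, h1, h2⟩ := exists_lin _ _ (hv.cross i j hij)
      refine ⟨l, hl, by simpa using h2, fun m hm => ?_⟩
      have : m = 0 := by fin_cases m <;> simp at hm ⊢
      subst this; simpa using h1)
  rw [finrank_sd] at hf
  have h6 : (1 + 2).choose 1 = 3 := by decide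
  have h1 : Module.finrank ℝ
      (Sd 1 ⊓ LinearMap.ker (evL ![v i, v j]) : Submodule ℝ MP) = 1 := by omega
  have hcm : c ∈ (Sd 1 ⊓ LinearMap.ker (evL ![v i, v j]) : Submodule ℝ MP) :=
    ⟨hc, (mem_ker_evL _ _).2 (by intro k; fin_cases k; exacts [h.1, h.2])⟩
  have hcm' : c' ∈ (Sd 1 ⊓ LinearMap.ker (evL ![v i, v j]) : Submodule ℝ MP) :=
    ⟨hc', (mem_ker_evL _ _).2 (by intro k; fin_cases k; exacts [h'.1, h'.2])⟩
  obtain ⟨r, hr⟩ := (finrank_eq_one_iff_of_nonzero' (⟨c, hcm⟩ : (Sd 1 ⊓ LinearMap.ker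
    (evL ![v i, v j]) : Submodule ℝ MP)) (by simpa using h0)).1 h1 ⟨c', hcm'⟩
  exact ⟨r, by simpa using (congrArg Subtype.val hr).symm⟩

lemma Gen.coprime (hv : Gen v) {f g : MP} (hf : f ∈ Sd 3) (hg : g ∈ Sd 3)
    (hfv : ∀ i, eval (v i) f = 0) (hgv : ∀ i, eval (v i) g = 0) (hi : Indep f g) :
    IsRelPrime f g := by
  obtain ⟨a, b, c, hab, hca, hcb⟩ :=
    UniqueFactorizationMonoid.exists_reduced_factors f hi.ne_left g
  have hf0 := hi.ne_left
  have hg0 := hi.ne_right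
  have hf' : (c * a).IsHomogeneous 3 := by rw [hca]; exact hf
  have hg' : (c * b).IsHomogeneous 3 := by rw [hcb]; exact hg
  obtain ⟨k, m, hkm, hck, ham⟩ := homog_factor hf' (by rw [hca]; exact hf0)
  obtain ⟨k', m', hkm', hck', hbm⟩ := homog_factor hg' (by rw [hcb]; exact hg0)
  have hc0 : c ≠ 0 := by rintro rfl; simp at hca; exact hf0 hca.symm
  have ha0 : a ≠ 0 := by rintro rfl; simp at hca; exact hf0 hca.symm
  obtain rfl : k = k' := hck.inj_right hck' hc0
  obtain rfl : m = m' := by omega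
  have hmul : ∀ r : ℝ, b = r • a → False := by
    intro r hr
    have := (hi (-r) 1 (by rw [← hca, ← hcb, hr]; simp [smul_eq_C_mul]; ring)).2
    norm_num at this
  have hzero : ∀ i, eval (v i) c ≠ 0 → eval (v i) a = 0 ∧ eval (v i) b = 0 := by
    intro i hi
    have h1 := hfv i
    have h2 := hgv i
    rw [← hca, map_mul] at h1
    rw [← hcb, map_mul] at h2
    exact ⟨(mul_eq_zero.1 h1).resolve_left hi, (mul_eq_zero.1 h2).resolve_left hi⟩
  classical
  have hsplit := Finset.card_filter_add_card_filter_not (s := (Finset.univ : Finset (Fin 8)))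
    (fun i => eval (v i) c = 0)
  rw [Finset.card_univ, Fintype.card_fin] at hsplit
  have hk : k = 0 ∨ k = 1 ∨ k = 2 ∨ k = 3 := by omega
  rcases hk with rfl | rfl | rfl | rfl
  · obtain ⟨r, rfl⟩ := homog_zero hck
    have hr : r ≠ 0 := by rintro rfl; simp at hc0
    have hu : IsUnit (C r : MP) := (isUnit_iff_ne_zero.2 hr).map C
    rw [← hca, ← hcb]
    exact (isRelPrime_mul_unit_left hu).2 hab
  · exfalso
    obtain rfl : m = 2 := by omega
    have h3 := hv.line c hck hc0 (Finset.univ.filter fun i => eval (v i) c = 0) (by simp)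
    obtain ⟨s, hs, hs5⟩ := Finset.exists_subset_card_eq
      (s := Finset.univ.filter fun i => ¬ eval (v i) c = 0) (n := 5) (by omega)
    have hmem : ∀ k, eval (v (s.orderEmbOfFin hs5 k)) c ≠ 0 := by
      intro k
      have := hs (s.orderEmbOfFin_mem hs5 k)
      simpa using this
    obtain ⟨r, hr⟩ := hv.conic_unique (s.orderEmbOfFin hs5) (s.orderEmbOfFin hs5).injective ham hbm
      (fun i => (hzero _ (hmem i)).1) (fun i => (hzero _ (hmem i)).2) ha0
    exact hmul r hr
  · exfalso
    obtain rfl : m = 1 := by omega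
    have h3 := hv.conic c hck hc0 (Finset.univ.filter fun i => eval (v i) c = 0) (by simp)
    obtain ⟨i, hi, j, hj, hij⟩ := Finset.one_lt_card.1
      (show 1 < (Finset.univ.filter fun i => ¬ eval (v i) c = 0).card by omega)
    have hi' := hzero i (by simpa using hi)
    have hj' := hzero j (by simpa using hj)
    obtain ⟨r, hr⟩ := hv.line_unique hij ham hbm ⟨hi'.1, hj'.1⟩ ⟨hi'.2, hj'.2⟩ ha0
    exact hmul r hr
  · exfalso
    obtain rfl : m = 0 := by omega
    obtain ⟨r, rfl⟩ := homog_zero ham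
    obtain ⟨s, rfl⟩ := homog_zero hbm
    have hr : r ≠ 0 := by rintro rfl; simp at ha0
    apply hmul (s / r)
    rw [smul_eq_C_mul, ← C_mul, div_mul_cancel₀ _ hr]

lemma Gen.sep7 (hv : Gen v) (P : Fin 8) :
    ∃ G ∈ Sd 7, eval (v P) G ≠ 0 ∧ ∀ j, j ≠ P → eval (v j) G = 0 := by
  have : ∀ j, ∃ l ∈ Sd 1, j ≠ P → eval (v j) l = 0 ∧ eval (v P) l ≠ 0 := by
    intro j
    by_cases h : j = P
    · exact ⟨0, Submodule.zero_mem _, fun h' => absurd h h'⟩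
    · obtain ⟨l, hl, h1⟩ := exists_lin _ _ (hv.cross j P h)
      exact ⟨l, hl, fun _ => h1⟩
  choose l hl h using this
  refine ⟨∏ j ∈ Finset.univ.erase P, l j, ?_, ?_, ?_⟩
  · have := IsHomogeneous.prod (Finset.univ.erase P) l (fun _ => 1) (fun j _ => hl j)
    simpa using this
  · rw [map_prod, Finset.prod_ne_zero_iff]
    intro j hj
    exact (h j (by simpa using hj)).2
  · intro j hj
    rw [map_prod]
    exact Finset.prod_eq_zero (i := j) (by simpa using hj) (h j hj).1

/-- Bézout: two independent cubics through the eight points cannot satisfy two further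
independent local conditions. -/
lemma Gen.bez (hv : Gen v) {f g : MP} (hf : f ∈ Sd 3) (hg : g ∈ Sd 3)
    (hfv : ∀ i, eval (v i) f = 0) (hgv : ∀ i, eval (v i) g = 0) (hi : Indep f g) (P : Fin 8)
    (φ ψ : MP →ₗ[ℝ] ℝ) (hφ : ∀ a, φ (a * f) = 0 ∧ φ (a * g) = 0)
    (hψ : ∀ a, ψ (a * f) = 0 ∧ ψ (a * g) = 0) (q r : MP) (hq : q ∈ Sd 2) (hr : r ∈ Sd 2)
    (hqP : eval (v P) q = 0) (hrP : eval (v P) r = 0)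
    (hφq : ∀ G, eval (v P) G ≠ 0 → φ (q * G) ≠ 0)
    (hφr : ∀ G, φ (r * G) = 0)
    (hψr : ∀ G, eval (v P) G ≠ 0 → ψ (r * G) ≠ 0) : False := by
  let L : MP →ₗ[ℝ] (Fin 8 → ℝ) × (ℝ × ℝ) := (evL v).prod (φ.prod ψ)
  have hL : ∀ F, L F = (evL v F, φ F, ψ F) := fun F => rfl
  have htop : (Sd 9).map L = ⊤ := by
    obtain ⟨G, hG, hGP, hGv⟩ := hv.sep7 P
    have hz : ∀ s : MP, eval (v P) s = 0 → evL v (s * G) = 0 := by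
      intro s hs
      ext j
      by_cases hj : j = P
      · subst hj; simp [hs]
      · simp [hGv j hj]
    have h1 : ∀ t : ℝ, ((0, 0, t) : (Fin 8 → ℝ) × (ℝ × ℝ)) ∈ (Sd 9).map L := by
      intro t
      refine ⟨(t / ψ (r * G)) • (r * G), Submodule.smul_mem _ _ (IsHomogeneous.mul hr hG), ?_⟩
      rw [map_smul, hL, hz r hrP, hφr]
      have := hψr G hGP
      simp [this]
    have h2 : ∀ t : ℝ, ((0, t, 0) : (Fin 8 → ℝ) × (ℝ × ℝ)) ∈ (Sd 9).map L := by
      intro t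
      have h3 : L ((t / φ (q * G)) • (q * G)) ∈ (Sd 9).map L :=
        ⟨_, Submodule.smul_mem _ _ (IsHomogeneous.mul hq hG), rfl⟩
      have h4 := Submodule.sub_mem _ h3 (h1 (ψ ((t / φ (q * G)) • (q * G))))
      convert h4 using 1
      rw [hL, map_smul, map_smul, hz q hqP]
      have := hφq G hGP
      simp [this]
    have h3 : ∀ i (t : ℝ), ((Pi.single i t, 0, 0) : (Fin 8 → ℝ) × (ℝ × ℝ)) ∈ (Sd 9).map L := by
      intro i t
      obtain ⟨K, hK, hKi, hKv⟩ := hv.sep7 i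
      have hne : v i ≠ 0 := by
        have := hv.cross i (i + 1) (by omega)
        intro h0
        apply this
        rw [h0]
        ext j; fin_cases j <;> simp [cr]
      have hd := (dt_self_pos hne).ne'
      set F := K * (lin (v i) * lin (v i)) with hF
      have hF9 : F ∈ Sd 9 := IsHomogeneous.mul hK ((lin_homog _).mul (lin_homog _))
      have hFi : eval (v i) F ≠ 0 := by
        rw [hF, map_mul, map_mul, eval_lin]
        exact mul_ne_zero hKi (mul_ne_zero hd hd)
      have h4 : L ((t / eval (v i) F) • F) ∈ (Sd 9).map L :=
        ⟨_, Submodule.smul_mem _ _ hF9, rfl⟩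
      have h5 := Submodule.sub_mem _ (Submodule.sub_mem _ h4 (h1 (ψ ((t / eval (v i) F) • F))))
        (h2 (φ ((t / eval (v i) F) • F)))
      convert h5 using 1
      rw [hL]
      ext j
      · by_cases hj : j = i
        · subst hj; simp [smul_eval, hFi]
        · simp [smul_eval, hF, hKv j hj, hj]
      · simp
      · simp
    rw [eq_top_iff]
    rintro ⟨y, s, t⟩ _
    have : ((y, s, t) : (Fin 8 → ℝ) × (ℝ × ℝ)) =
        (∑ i, (Pi.single i (y i), 0, 0)) + (0, s, 0) + (0, 0, t) := by
      ext j
      · simp [Prod.fst_sum, Finset.sum_apply, Pi.single_apply]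
      · simp [Prod.fst_sum, Prod.snd_sum]
      · simp [Prod.fst_sum, Prod.snd_sum]
    rw [this]
    exact Submodule.add_mem _ (Submodule.add_mem _ (Submodule.sum_mem _ fun i _ => h3 i _) (h2 s))
      (h1 t)
  have hker := finrank_inf_ker (Sd 9) L
  rw [htop, finrank_top, finrank_sd] at hker
  simp only [Module.finrank_prod, Module.finrank_fin_fun, Module.finrank_self] at hker
  have h55 : (9 + 2).choose 9 = 55 := by decide
  have h28 : (6 + 2).choose 6 = 28 := by decide
  have h10 : (3 + 2).choose 3 = 10 := by decide
  -- Koszul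
  let Φ : MP × MP →ₗ[ℝ] MP := (LinearMap.mulRight ℝ f).coprod (LinearMap.mulRight ℝ g)
  let Ψ : MP →ₗ[ℝ] MP × MP := (LinearMap.mulRight ℝ g).prod (-(LinearMap.mulRight ℝ f))
  let S : Submodule ℝ (MP × MP) := (Sd 6).prod (Sd 6)
  let eS : S ≃ₗ[ℝ] (Sd 6 × Sd 6) :=
    { toFun := fun x => (⟨x.1.1, x.2.1⟩, ⟨x.1.2, x.2.2⟩)
      invFun := fun x => ⟨(x.1.1, x.2.1), x.1.2, x.2.2⟩
      map_add' := fun _ _ => rfl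
      map_smul' := fun _ _ => rfl
      left_inv := fun _ => rfl
      right_inv := fun _ => rfl }
  haveI : FiniteDimensional ℝ S := LinearEquiv.finiteDimensional eS.symm
  have hS : Module.finrank ℝ S = 56 := by
    rw [eS.finrank_eq, Module.finrank_prod, finrank_sd, h28]
  have hk2 := finrank_inf_ker S Φ
  have hle : S ⊓ LinearMap.ker Φ ≤ (Sd 3).map Ψ := by
    rintro ⟨a, b⟩ ⟨⟨ha, hb⟩, hab⟩
    have hab' : a * f + b * g = 0 := hab
    have hrel := hv.coprime hf hg hfv hgv hi
    have hdvd : g ∣ a * f := ⟨-b, by linear_combination hab'⟩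
    obtain ⟨c, hc⟩ := hrel.symm.dvd_of_dvd_mul_right hdvd
    have hb' : b = -(c * f) := by
      apply mul_right_cancel₀ hi.ne_right
      rw [hc] at hab'
      linear_combination hab'
    refine ⟨c, ?_, ?_⟩
    · by_cases hc0 : c = 0
      · rw [hc0]; exact Submodule.zero_mem _
      · have ha' : (g * c).IsHomogeneous 6 := by rw [← hc]; exact ha
        obtain ⟨x, y, hxy, hx, hy⟩ := homog_factor ha' (mul_ne_zero hi.ne_right hc0)
        obtain rfl : x = 3 := hx.inj_right hg hi.ne_right
        obtain rfl : y = 3 := by omega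
        exact hy
    · change (c * g, -(c * f)) = (a, b)
      rw [hc, hb', mul_comm]
  haveI : FiniteDimensional ℝ ((Sd 3).map Ψ) := inferInstance
  have h1 := Submodule.finrank_mono hle
  have h2 := Submodule.finrank_map_le Ψ (Sd 3)
  rw [finrank_sd] at h2
  have hle2 : S.map Φ ≤ Sd 9 ⊓ LinearMap.ker L := by
    rintro _ ⟨⟨a, b⟩, ⟨ha, hb⟩, rfl⟩
    have e : Φ (a, b) = a * f + b * g := rfl
    rw [e]
    refine ⟨?_, ?_⟩
    · exact Submodule.add_mem _ (IsHomogeneous.mul ha hf) (IsHomogeneous.mul hb hg)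
    · change L _ = 0
      rw [hL, map_add φ, map_add ψ, (hφ a).1, (hφ b).2, (hψ a).1, (hψ b).2]
      have : evL v (a * f + b * g) = 0 := by
        ext j; simp [hfv, hgv]
      rw [this]; simp
  haveI : FiniteDimensional ℝ (Sd 9 ⊓ LinearMap.ker L : Submodule ℝ MP) :=
    Submodule.finiteDimensional_of_le inf_le_left
  have h3 := Submodule.finrank_mono hle2
  omega

end

/-! ### Derivatives -/

def gr (F : MP) (x : V3) : V3 := fun k => eval x (pderiv k F)

def hess (F : MP) (x : V3) (k : Fin 3) : V3 := fun j => eval x (pderiv k (pderiv j F))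

lemma gr_mul (a b : MP) (x : V3) : gr (a * b) x = eval x a • gr b x + eval x b • gr a x := by
  ext k; simp [gr, Derivation.leibniz]

lemma gr_add (a b : MP) (x : V3) : gr (a + b) x = gr a x + gr b x := by
  ext k; simp [gr]

lemma gr_smul (r : ℝ) (b : MP) (x : V3) : gr (r • b) x = r • gr b x := by
  ext k; simp [gr]

lemma euler {n : ℕ} {F : MP} (h : F ∈ Sd n) (x : V3) : dt x (gr F x) = n * eval x F := by
  have h1 : F.IsHomogeneous n := h
  have := congrArg (eval x) h1.sum_X_mul_pderiv
  simpa [Fin.sum_univ_three, dt, gr] using this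

lemma euler2 {n : ℕ} {F : MP} (h : F ∈ Sd n) (x : V3) (k : Fin 3) :
    dt x (hess F x k) = (n - 1) * gr F x k := by
  have h1 : F.IsHomogeneous n := h
  have := congrArg (fun q => eval x (pderiv k q)) h1.sum_X_mul_pderiv
  simp only [Fin.sum_univ_three, map_add, Derivation.leibniz, pderiv_X, smul_eq_mul, map_mul,
    eval_X, map_nsmul, nsmul_eq_mul] at this
  simp only [dt, gr, hess]
  fin_cases k <;> simp at this ⊢ <;> linarith

/-- Directional derivative. -/
def DD (t : V3) : Derivation ℝ MP MP := mkDerivation ℝ (fun k => C (t k))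

lemma DD_eq (t : V3) (F : MP) :
    DD t F = C (t 0) * pderiv 0 F + C (t 1) * pderiv 1 F + C (t 2) * pderiv 2 F := by
  have : DD t = (C (t 0) : MP) • (pderiv 0 : Derivation ℝ MP MP) + (C (t 1) : MP) • (pderiv 1 : Derivation ℝ MP MP) +
      (C (t 2) : MP) • (pderiv 2 : Derivation ℝ MP MP) := by
    apply derivation_ext
    intro i
    fin_cases i <;> simp [DD, mkDerivation_X, pderiv_X]
  rw [this]; simp

lemma DD_lin (t w : V3) : DD t (lin w) = C (dt w t) := by
  simp [lin, DD_eq, dt, Derivation.leibniz, pderiv_X]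
  ring

lemma eval_DD (t : V3) (F : MP) (x : V3) : eval x (DD t F) = dt t (gr F x) := by
  simp [DD_eq, dt, gr]

lemma eval_DD2 (t : V3) (F : MP) (x : V3) : eval x (DD t (DD t F)) =
    dt (fun j => t 0 * hess F x 0 j + t 1 * hess F x 1 j + t 2 * hess F x 2 j) t := by
  simp [DD_eq, dt, hess, Derivation.leibniz]
  ring

/-- The Jacobian. -/
def Jac (f g h : MP) : MP :=
  (pderiv 1 f * pderiv 2 g - pderiv 2 f * pderiv 1 g) * pderiv 0 h +
  (pderiv 2 f * pderiv 0 g - pderiv 0 f * pderiv 2 g) * pderiv 1 h +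
  (pderiv 0 f * pderiv 1 g - pderiv 1 f * pderiv 0 g) * pderiv 2 h

lemma jac_mem {f g h : MP} (hf : f ∈ Sd 3) (hg : g ∈ Sd 3) (hh : h ∈ Sd 3) : Jac f g h ∈ Sd 6 := by
  have d : ∀ {f : MP}, f ∈ Sd 3 → ∀ i, (pderiv i f).IsHomogeneous 2 := fun h i =>
    IsHomogeneous.pderiv (n := 3) h
  have hm : ∀ i j k l m : Fin 3, (pderiv i f * pderiv j g - pderiv k f * pderiv l g) * pderiv m h
      ∈ Sd 6 := fun i j k l m =>
    (((d hf i).mul (d hg j)).sub ((d hf k).mul (d hg l))).mul (d hh m)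
  exact Submodule.add_mem _ (Submodule.add_mem _ (hm _ _ _ _ _) (hm _ _ _ _ _)) (hm _ _ _ _ _)

lemma eval_jac (f g h : MP) (x : V3) :
    eval x (Jac f g h) = det3 (gr f x) (gr g x) (gr h x) := by
  simp [Jac, det3_def, gr]

lemma gr_jac (f g h : MP) (x : V3) (k : Fin 3) : gr (Jac f g h) x k =
    det3 (hess f x k) (gr g x) (gr h x) + det3 (gr f x) (hess g x k) (gr h x) +
    det3 (gr f x) (gr g x) (hess h x k) := by
  simp only [gr, Jac, det3_def, hess, map_add, map_sub, Derivation.leibniz, smul_eq_mul, map_mul]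
  ring

lemma sum_det_zero (A B D A' B' D' Q : V3) (hQ : Q ≠ 0) (k : Fin 3) (h1 : dt Q A = 0)
    (h2 : dt Q B = 0) (h3 : dt Q D = 0) (h1' : dt Q A' = 2 * A k) (h2' : dt Q B' = 2 * B k)
    (h3' : dt Q D' = 2 * D k) : det3 A' B D + det3 A B' D + det3 A B D' = 0 := by
  have hdet : det3 A B D = 0 := by
    have : ∀ i, Q i * det3 A B D = 0 := by
      intro i
      simp only [dt, det3_def] at *
      fin_cases i <;> simp only [Fin.zero_eta, Fin.mk_one, Fin.reduceFinMk]
      · linear_combination (B 1 * D 2 - B 2 * D 1) * h1 + (D 1 * A 2 - D 2 * A 1) * h2 +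
          (A 1 * B 2 - A 2 * B 1) * h3
      · linear_combination (B 2 * D 0 - B 0 * D 2) * h1 + (D 2 * A 0 - D 0 * A 2) * h2 +
          (A 2 * B 0 - A 0 * B 2) * h3
      · linear_combination (B 0 * D 1 - B 1 * D 0) * h1 + (D 0 * A 1 - D 1 * A 0) * h2 +
          (A 0 * B 1 - A 1 * B 0) * h3
    obtain ⟨i, hi⟩ := Function.ne_iff.1 hQ
    exact (mul_eq_zero.1 (this i)).resolve_left hi
  have key : ∀ i, Q i * (det3 A' B D + det3 A B' D + det3 A B D') = 0 := by
    intro i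
    have e0 : (A' 0 * Q 0 + A' 1 * Q 1 + A' 2 * Q 2) = 2 * A k := by rw [← h1']; simp [dt]; ring
    have e1 : (B' 0 * Q 0 + B' 1 * Q 1 + B' 2 * Q 2) = 2 * B k := by rw [← h2']; simp [dt]; ring
    have e2 : (D' 0 * Q 0 + D' 1 * Q 1 + D' 2 * Q 2) = 2 * D k := by rw [← h3']; simp [dt]; ring
    have c : Q i * (det3 A' B D + det3 A B' D + det3 A B D') =
        2 * (A k * cr B D i + B k * cr D A i + D k * cr A B i) := by
      clear h1' h2' h3' hdet
      simp only [dt, det3_def] at *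
      fin_cases i <;> simp [cr]
      · linear_combination (B 1 * D 2 - B 2 * D 1) * e0 + (D 1 * A 2 - D 2 * A 1) * e1 +
          (A 1 * B 2 - A 2 * B 1) * e2 + (D 1 * A' 2 - D 2 * A' 1 + D' 1 * A 2 - D' 2 * A 1) * h2 +
          (A' 1 * B 2 - A' 2 * B 1 + A 1 * B' 2 - A 2 * B' 1) * h3 +
          (B' 1 * D 2 - B' 2 * D 1 + B 1 * D' 2 - B 2 * D' 1) * h1
      · linear_combination (B 2 * D 0 - B 0 * D 2) * e0 + (D 2 * A 0 - D 0 * A 2) * e1 +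
          (A 2 * B 0 - A 0 * B 2) * e2 + (D 2 * A' 0 - D 0 * A' 2 + D' 2 * A 0 - D' 0 * A 2) * h2 +
          (A' 2 * B 0 - A' 0 * B 2 + A 2 * B' 0 - A 0 * B' 2) * h3 +
          (B' 2 * D 0 - B' 0 * D 2 + B 2 * D' 0 - B 0 * D' 2) * h1
      · linear_combination (B 0 * D 1 - B 1 * D 0) * e0 + (D 0 * A 1 - D 1 * A 0) * e1 +
          (A 0 * B 1 - A 1 * B 0) * e2 + (D 0 * A' 1 - D 1 * A' 0 + D' 0 * A 1 - D' 1 * A 0) * h2 +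
          (A' 0 * B 1 - A' 1 * B 0 + A 0 * B' 1 - A 1 * B' 0) * h3 +
          (B' 0 * D 1 - B' 1 * D 0 + B 0 * D' 1 - B 1 * D' 0) * h1
    rw [c]
    rw [det3_def] at hdet
    fin_cases i <;> fin_cases k <;> simp [cr] <;> first | ring1 | linear_combination hdet
  obtain ⟨i, hi⟩ := Function.ne_iff.1 hQ
  exact (mul_eq_zero.1 (key i)).resolve_left hi

lemma gr_jac_zero {f g h : MP} (hf : f ∈ Sd 3) (hg : g ∈ Sd 3) (hh : h ∈ Sd 3) {x : V3}
    (hx : x ≠ 0) (h1 : eval x f = 0) (h2 : eval x g = 0) (h3 : eval x h = 0) :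
    gr (Jac f g h) x = 0 := by
  ext k
  rw [gr_jac]
  have e1 := euler2 hf x k
  have e2 := euler2 hg x k
  have e3 := euler2 hh x k
  norm_num at e1 e2 e3
  exact sum_det_zero _ _ _ _ _ _ x hx k (by rw [euler hf, h1, mul_zero])
    (by rw [euler hg, h2, mul_zero]) (by rw [euler hh, h3, mul_zero]) e1 e2 e3

section
variable {v : Fin 8 → V3}

lemma Gen.ne (hv : Gen v) (i : Fin 8) : v i ≠ 0 := by
  have := hv.cross i (i + 1) (by omega)
  intro h0
  apply this
  rw [h0]
  ext j; fin_cases j <;> simp [cr]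

lemma cr_ne {p n : V3} (hp : p ≠ 0) (hn : n ≠ 0) (h : dt p n = 0) : cr p n ≠ 0 := by
  intro h0
  have h1 : dt (cr p n) (cr p n) = dt p p * dt n n - dt p n * dt p n := by
    simp [dt, cr]; ring
  rw [h0, h] at h1
  have h2 := mul_pos (dt_self_pos hp) (dt_self_pos hn)
  have h3 : dt (0 : V3) 0 = 0 := by simp [dt]
  linarith

lemma dt_cr1 (p n : V3) : dt p (cr p n) = 0 := by simp [dt, cr]; ring
lemma dt_cr2 (p n : V3) : dt n (cr p n) = 0 := by simp [dt, cr]; ring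
lemma dt_comm (p n : V3) : dt p n = dt n p := by simp [dt]; ring

/-- Case A: all cubics singular at `P`. -/
lemma Gen.caseA (hv : Gen v) {f g : MP} (hf : f ∈ Sd 3) (hg : g ∈ Sd 3)
    (hfv : ∀ i, eval (v i) f = 0) (hgv : ∀ i, eval (v i) g = 0) (hi : Indep f g) (P : Fin 8)
    (h1 : gr f (v P) = 0) (h2 : gr g (v P) = 0) : False := by
  set p := v P with hp
  have hp0 : p ≠ 0 := hv.ne P
  have hn0 : cr p (v (P + 1)) ≠ 0 := hv.cross P (P + 1) (by omega)
  set n := cr p (v (P + 1)) with hn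
  have hpn : dt p n = 0 := dt_cr1 _ _
  have ht0 := cr_ne hp0 hn0 hpn
  set t := cr p n with ht
  have hpt : dt p t = 0 := dt_cr1 _ _
  have hnt : dt n t = 0 := dt_cr2 _ _
  have ppp := (dt_self_pos hp0).ne'
  have pnn := (dt_self_pos hn0).ne'
  have ptt := (dt_self_pos ht0).ne'
  have hz : ∀ w : V3, dt w (0 : V3) = 0 := fun w => by simp [dt]
  have hfp : eval p f = 0 := hfv P
  have hgp : eval p g = 0 := hgv P
  refine hv.bez hf hg hfv hgv hi P ((aeval p : MP →ₐ[ℝ] ℝ).toLinearMap ∘ₗ (DD t).toLinearMap)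
    ((aeval p : MP →ₐ[ℝ] ℝ).toLinearMap ∘ₗ (DD n).toLinearMap) ?_ ?_ (lin p * lin t)
    (lin p * lin n) ((lin_homog _).mul (lin_homog _)) ((lin_homog _).mul (lin_homog _))
    ?_ ?_ ?_ ?_ ?_
  · intro a
    simp [aeval_eq_eval, Derivation.leibniz, eval_DD, h1, h2, hz, hfp, hgp]
  · intro a
    simp [aeval_eq_eval, Derivation.leibniz, eval_DD, h1, h2, hz, hfp, hgp]
  · simp [← hp, dt_comm t p, hpt]
  · simp [← hp, dt_comm n p, hpn]
  · intro G hG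
    simp [aeval_eq_eval, Derivation.leibniz, DD_lin, dt_comm t p, hpt]
    exact ⟨hG, ppp, ptt⟩
  · intro G
    simp [aeval_eq_eval, Derivation.leibniz, DD_lin, dt_comm n p, hpn, hnt]
  · intro G hG
    simp [aeval_eq_eval, Derivation.leibniz, DD_lin, dt_comm n p, hpn]
    exact ⟨hG, ppp, pnn⟩

/-- Case B: intersection multiplicity at least three at `P`. -/
lemma Gen.caseB (hv : Gen v) {f g : MP} (hf : f ∈ Sd 3) (hg : g ∈ Sd 3)
    (hfv : ∀ i, eval (v i) f = 0) (hgv : ∀ i, eval (v i) g = 0) (hi : Indep f g) (P : Fin 8)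
    (h1 : gr f (v P) = 0) (b t : V3) (hb : gr g (v P) = b) (hb0 : b ≠ 0) (ht : t = cr (v P) b)
    (h2 : eval (v P) (DD t (DD t f)) = 0) : False := by
  set p := v P with hp
  have hp0 : p ≠ 0 := hv.ne P
  have hpb : dt p b = 0 := by rw [← hb, euler hg, hp, hgv, mul_zero]
  have ht0 : t ≠ 0 := ht ▸ cr_ne hp0 hb0 hpb
  have hpt : dt p t = 0 := ht ▸ dt_cr1 _ _
  have hbt : dt b t = 0 := ht ▸ dt_cr2 _ _
  have htb : dt t b = 0 := by rw [dt_comm, hbt]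
  have htp : dt t p = 0 := by rw [dt_comm, hpt]
  have ppp := (dt_self_pos hp0).ne'
  have pbb := (dt_self_pos hb0).ne'
  have ptt := (dt_self_pos ht0).ne'
  have hz : ∀ w : V3, dt w (0 : V3) = 0 := fun w => by simp [dt]
  have hfp : eval p f = 0 := hfv P
  have hgp : eval p g = 0 := hgv P
  refine hv.bez hf hg hfv hgv hi P ((aeval p : MP →ₐ[ℝ] ℝ).toLinearMap ∘ₗ (DD t).toLinearMap)
    (dt b b • ((aeval p : MP →ₐ[ℝ] ℝ).toLinearMap ∘ₗ (DD t).toLinearMap ∘ₗ (DD t).toLinearMap) -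
      eval p (DD t (DD t g)) • ((aeval p : MP →ₐ[ℝ] ℝ).toLinearMap ∘ₗ (DD b).toLinearMap))
    ?_ ?_ (lin p * lin t)
    (lin t * lin t) ((lin_homog _).mul (lin_homog _)) ((lin_homog _).mul (lin_homog _))
    ?_ ?_ ?_ ?_ ?_
  · intro a
    simp [aeval_eq_eval, Derivation.leibniz, eval_DD, h1, hb, hz, hfp, hgp, htb]
  · intro a
    constructor
    · simp [aeval_eq_eval, Derivation.leibniz, h2, eval_DD _ f, h1, hz, hfp]
    · simp [aeval_eq_eval, Derivation.leibniz, eval_DD _ g, hb, hgp, htb]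
      ring
  · simp [← hp, htp]
  · simp [← hp, htp]
  · intro G hG
    simp [aeval_eq_eval, Derivation.leibniz, DD_lin, htp]
    exact ⟨hG, ppp, ptt⟩
  · intro G
    simp [aeval_eq_eval, Derivation.leibniz, DD_lin, htp]
  · intro G hG
    have hG' : eval p G ≠ 0 := hG
    simp [aeval_eq_eval, Derivation.leibniz, DD_lin, htp, htb]
    exact ⟨pbb, hG', ptt⟩

end

/-! ### Gradients at one point -/

lemma gram (a b c x y z : V3) : det3 a b c * det3 x y z =
    dt a x * (dt b y * dt c z - dt b z * dt c y) - dt a y * (dt b x * dt c z - dt b z * dt c x) +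
    dt a z * (dt b x * dt c y - dt b y * dt c x) := by
  simp only [det3_def, dt]; ring

lemma det3_zero1 (b c : V3) : det3 0 b c = 0 := by simp [det3_def]

lemma gr_prod_zero {a b : MP} {x : V3} (h1 : eval x a = 0) (h2 : eval x b = 0) :
    gr (a * b) x = 0 := by
  rw [gr_mul, h1, h2]; simp

section
variable {v : Fin 8 → V3}

lemma Gen.local2 (hv : Gen v) {f g h : MP} (hf : f ∈ Sd 3) (hg : g ∈ Sd 3) (hh : h ∈ Sd 3)
    (hfv : ∀ i, eval (v i) f = 0) (hgv : ∀ i, eval (v i) g = 0) (hi : Indep f g) (P : Fin 8)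
    (hhP : eval (v P) h ≠ 0) (hhv : ∀ j, j ≠ P → eval (v j) h = 0) (h1 : gr f (v P) = 0) :
    ∃ F1 ∈ Sd 6, ∃ F2 ∈ Sd 6, ∃ F3 ∈ Sd 6,
      (∀ j, j ≠ P → gr F1 (v j) = 0 ∧ gr F2 (v j) = 0 ∧ gr F3 (v j) = 0) ∧
      det3 (gr F1 (v P)) (gr F2 (v P)) (gr F3 (v P)) ≠ 0 := by
  by_cases hb0 : gr g (v P) = 0
  · exact (hv.caseA hf hg hfv hgv hi P h1 hb0).elim
  by_cases h2 : eval (v P) (DD (cr (v P) (gr g (v P))) (DD (cr (v P) (gr g (v P))) f)) = 0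
  · exact (hv.caseB hf hg hfv hgv hi P h1 _ _ rfl hb0 rfl h2).elim
  refine ⟨h * h, IsHomogeneous.mul hh hh, h * g, IsHomogeneous.mul hh hg, Jac f g h,
    jac_mem hf hg hh, ?_, ?_⟩
  · intro j hj
    exact ⟨gr_prod_zero (hhv j hj) (hhv j hj), gr_prod_zero (hhv j hj) (hgv j),
      gr_jac_zero hf hg hh (hv.ne j) (hfv j) (hgv j) (hhv j hj)⟩
  rw [eval_DD2] at h2
  have hw : ∀ k, gr (Jac f g h) (v P) k = det3 (hess f (v P) k) (gr g (v P)) (gr h (v P)) := by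
    intro k
    rw [gr_jac, h1]
    simp [det3_def]
  have e0 := euler (jac_mem hf hg hh) (v P)
  rw [eval_jac, h1, det3_zero1, mul_zero] at e0
  have eu := euler hh (v P)
  have eb := euler hg (v P)
  rw [hgv P, mul_zero] at eb
  have hp0 := hv.ne P
  have hsk : ∀ k, dt (v P) (hess f (v P) k) = 0 := by
    intro k
    rw [euler2 hf, h1]; simp
  rw [gr_mul, gr_mul, hgv P]
  set p := v P with hp
  set b := gr g p with hb
  set u := gr h p with hu
  set w := gr (Jac f g h) p with hwd
  set t := cr p b with ht
  set s : V3 := fun j => t 0 * hess f p 0 j + t 1 * hess f p 1 j + t 2 * hess f p 2 j with hs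
  have hbp : dt b p = 0 := by rw [dt_comm, eb]
  have hbt : dt b t = 0 := dt_cr2 _ _
  have hwp : dt w p = 0 := by rw [dt_comm, e0]
  have hsp : dt s p = 0 := by
    have : dt s p = t 0 * dt p (hess f p 0) + t 1 * dt p (hess f p 1) +
        t 2 * dt p (hess f p 2) := by
      simp only [dt, hs]; ring
    rw [this, hsk, hsk, hsk]; ring
  have hup : dt u p ≠ 0 := by
    rw [dt_comm, eu]
    exact mul_ne_zero (by norm_num) hhP
  have hbb := (dt_self_pos hb0).ne'
  have hwt : dt w t = det3 s b u := by
    have : dt w t = t 0 * w 0 + t 1 * w 1 + t 2 * w 2 := by simp only [dt]; ring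
    rw [this, hw, hw, hw]
    simp only [det3_def, hs]; ring
  have g1 := gram s b u p t b
  rw [hsp, hbp, hbt] at g1
  have n1 : det3 s b u ≠ 0 := by
    intro h0
    rw [h0] at g1
    have : dt s t * dt b b * dt u p = 0 := by linear_combination -g1
    exact mul_ne_zero (mul_ne_zero h2 hbb) hup this
  have g2 := gram u b w p t b
  rw [hbp, hbt, hwp, hwt] at g2
  have n2 : det3 u b w ≠ 0 := by
    intro h0
    rw [h0] at g2
    have : dt u p * dt b b * det3 s b u = 0 := by linear_combination g2
    exact mul_ne_zero (mul_ne_zero hup hbb) n1 this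
  have : det3 (eval p h • u + eval p h • u) (eval p h • b + (0 : ℝ) • u) w =
      2 * eval p h * eval p h * det3 u b w := by
    simp only [det3_def, Pi.add_apply, Pi.smul_apply, smul_eq_mul]; ring
  rw [this]
  exact mul_ne_zero (mul_ne_zero (mul_ne_zero two_ne_zero hhP) hhP) n2

lemma Gen.loc (hv : Gen v) {f g h : MP} (hf : f ∈ Sd 3) (hg : g ∈ Sd 3) (hh : h ∈ Sd 3)
    (hfv : ∀ i, eval (v i) f = 0) (hgv : ∀ i, eval (v i) g = 0) (hi : Indep f g) (P : Fin 8)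
    (hhP : eval (v P) h ≠ 0) (hhv : ∀ j, j ≠ P → eval (v j) h = 0) :
    ∃ F1 ∈ Sd 6, ∃ F2 ∈ Sd 6, ∃ F3 ∈ Sd 6,
      (∀ j, j ≠ P → gr F1 (v j) = 0 ∧ gr F2 (v j) = 0 ∧ gr F3 (v j) = 0) ∧
      det3 (gr F1 (v P)) (gr F2 (v P)) (gr F3 (v P)) ≠ 0 := by
  by_cases h0 : det3 (gr h (v P)) (gr f (v P)) (gr g (v P)) = 0
  swap
  · refine ⟨h * h, IsHomogeneous.mul hh hh, h * f, IsHomogeneous.mul hh hf, h * g,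
      IsHomogeneous.mul hh hg, ?_, ?_⟩
    · intro j hj
      exact ⟨gr_prod_zero (hhv j hj) (hhv j hj), gr_prod_zero (hhv j hj) (hfv j),
        gr_prod_zero (hhv j hj) (hgv j)⟩
    · rw [gr_mul, gr_mul, gr_mul, hfv P, hgv P]
      have : ∀ (r : ℝ) (u a b : V3), det3 (r • u + r • u) (r • a + (0 : ℝ) • u)
          (r • b + (0 : ℝ) • u) = 2 * r * r * r * det3 u a b := by
        intro r u a b
        simp only [det3_def, Pi.add_apply, Pi.smul_apply, smul_eq_mul]; ring
      rw [this]
      exact mul_ne_zero (mul_ne_zero (mul_ne_zero (mul_ne_zero two_ne_zero hhP) hhP) hhP) h0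
  by_cases ha0 : gr f (v P) = 0
  · exact hv.local2 hf hg hh hfv hgv hi P hhP hhv ha0
  have ea := euler hf (v P)
  have eb := euler hg (v P)
  have eu := euler hh (v P)
  rw [hfv P, mul_zero] at ea
  rw [hgv P, mul_zero] at eb
  have hup : dt (v P) (gr h (v P)) ≠ 0 := by
    rw [eu]; exact mul_ne_zero (by norm_num) hhP
  have haa := (dt_self_pos ha0).ne'
  have hcr : cr (gr f (v P)) (gr g (v P)) = 0 := by
    generalize gr f (v P) = a at *
    generalize gr g (v P) = b at *
    generalize gr h (v P) = u at *
    generalize v P = p at *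
    simp only [det3_def, dt] at *
    ext i
    apply mul_left_cancel₀ hup
    fin_cases i
    · change _ * (a 1 * b 2 - a 2 * b 1) = _ * (0 : ℝ)
      linear_combination (p 0) * h0 + (u 1 * b 2 - u 2 * b 1) * ea - (u 1 * a 2 - u 2 * a 1) * eb
    · change _ * (a 2 * b 0 - a 0 * b 2) = _ * (0 : ℝ)
      linear_combination (p 1) * h0 + (u 2 * b 0 - u 0 * b 2) * ea - (u 2 * a 0 - u 0 * a 2) * eb
    · change _ * (a 0 * b 1 - a 1 * b 0) = _ * (0 : ℝ)
      linear_combination (p 2) * h0 + (u 0 * b 1 - u 1 * b 0) * ea - (u 0 * a 1 - u 1 * a 0) * eb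
  set a := gr f (v P) with ha
  set b := gr g (v P) with hb
  refine hv.local2 (f := (-dt a b) • f + (dt a a) • g) (g := f) (Submodule.add_mem _ (Submodule.smul_mem _ _ hf)
    (Submodule.smul_mem _ _ hg)) hf hh ?_ hfv ?_ P hhP hhv ?_
  · intro i
    simp [smul_eval, hfv, hgv]
  · intro α β h
    have := hi (-(α * dt a b) + β) (α * dt a a) (by rw [← h]; module)
    have h3 := (mul_eq_zero.1 this.2).resolve_right haa
    refine ⟨h3, ?_⟩
    simpa [h3] using this.1
  · rw [gr_add, gr_smul, gr_smul, ← ha, ← hb]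
    have k0 : a 1 * b 2 - a 2 * b 1 = 0 := by simpa [cr] using congrFun hcr 0
    have k1 : a 2 * b 0 - a 0 * b 2 = 0 := by simpa [cr] using congrFun hcr 1
    have k2 : a 0 * b 1 - a 1 * b 0 = 0 := by simpa [cr] using congrFun hcr 2
    ext i
    fin_cases i <;> simp [dt]
    · linear_combination (a 2) * k1 - (a 1) * k2
    · linear_combination (a 0) * k2 - (a 2) * k0
    · linear_combination (a 1) * k0 - (a 0) * k1

/-- Gradients at a family of points. -/
def grL (v : Fin 8 → V3) : MP →ₗ[ℝ] (Fin 8 → V3) where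
  toFun F := fun i => gr F (v i)
  map_add' a b := by ext i; simp [gr_add]
  map_smul' r b := by ext i; simp [gr_smul]

lemma grL_apply (F : MP) (i : Fin 8) : grL v F i = gr F (v i) := rfl

/-- Cramer. -/
lemma cramer {a b c : V3} (h : det3 a b c ≠ 0) (y : V3) : ∃ α β γ : ℝ,
    α • a + β • b + γ • c = y := by
  refine ⟨det3 y b c / det3 a b c, det3 a y c / det3 a b c, det3 a b y / det3 a b c, ?_⟩
  ext i
  apply mul_left_cancel₀ h
  simp only [Pi.add_apply, Pi.smul_apply, smul_eq_mul]
  field_simp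
  simp only [det3_def]
  fin_cases i <;> simp <;> ring

lemma Gen.exists_basis (hv : Gen v) : ∃ f ∈ Sd 3, ∃ g ∈ Sd 3, (∀ i, eval (v i) f = 0) ∧
    (∀ i, eval (v i) g = 0) ∧ Indep f g ∧
    ∀ q ∈ Sd 3, (∀ i, eval (v i) q = 0) → ∃ α β : ℝ, q = α • f + β • g := by
  have h := hv.finrank3
  have : FiniteDimensional ℝ (Sd 3 ⊓ LinearMap.ker (evL v) : Submodule ℝ MP) :=
    Module.finite_of_finrank_pos (by omega)
  let B := Module.finBasisOfFinrankEq ℝ (Sd 3 ⊓ LinearMap.ker (evL v) : Submodule ℝ MP) h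
  refine ⟨B 0, (B 0).2.1, B 1, (B 1).2.1, (mem_ker_evL _ _).1 (B 0).2.2,
    (mem_ker_evL _ _).1 (B 1).2.2, ?_, ?_⟩
  · intro α β h
    have h2 : α • B 0 + β • B 1 = 0 := by
      apply Subtype.ext; simpa using h
    have h3 := Fintype.linearIndependent_iff.1 B.linearIndependent ![α, β]
      (by rw [Fin.sum_univ_two]; exact h2)
    exact ⟨h3 0, h3 1⟩
  · intro q hq hqv
    have := B.sum_repr ⟨q, hq, (mem_ker_evL _ _).2 hqv⟩
    rw [Fin.sum_univ_two] at this
    exact ⟨_, _, (congrArg Subtype.val this).symm⟩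

lemma Gen.finrank6 (hv : Gen v) :
    Module.finrank ℝ (Sd 6 ⊓ LinearMap.ker (grL v) : Submodule ℝ MP) = 4 := by
  obtain ⟨f, hf, g, hg, hfv, hgv, hi, -⟩ := hv.exists_basis
  have h1 := finrank_inf_ker (Sd 6) (grL v)
  have h2 : (Sd 6).map (grL v) = ⊤ := by
    rw [eq_top_iff]
    intro y _
    have : y = ∑ i, Pi.single i (y i) := (Finset.univ_sum_single y).symm
    rw [this]
    refine Submodule.sum_mem _ fun P _ => ?_
    obtain ⟨h, hh, hhP, hhv⟩ := hv.cubic_sep P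
    obtain ⟨F1, m1, F2, m2, F3, m3, hz, hd⟩ := hv.loc hf hg hh hfv hgv hi P hhP hhv
    obtain ⟨α, β, γ, hy⟩ := cramer hd (y P)
    refine ⟨α • F1 + β • F2 + γ • F3, Submodule.add_mem _ (Submodule.add_mem _
      (Submodule.smul_mem _ _ m1) (Submodule.smul_mem _ _ m2)) (Submodule.smul_mem _ _ m3), ?_⟩
    funext j
    rw [grL_apply, gr_add, gr_add, gr_smul, gr_smul, gr_smul]
    by_cases hj : j = P
    · subst hj; rw [hy]; simp
    · obtain ⟨z1, z2, z3⟩ := hz j hj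
      rw [z1, z2, z3]; simp [hj]
  rw [h2, finrank_sd] at h1
  have h28 : (6 + 2).choose 6 = 28 := by decide
  have h24 : Module.finrank ℝ (⊤ : Submodule ℝ (Fin 8 → V3)) = 24 := by
    rw [finrank_top, Module.finrank_pi_fintype]; simp
  omega

end

/-! ### Squares -/

lemma sq_indep {f g : MP} (hi : Indep f g) (a b c : ℝ)
    (h : a • (f * f) + b • (f * g) + c • (g * g) = 0) : a = 0 ∧ b = 0 ∧ c = 0 := by
  have hg := hi.ne_right
  by_cases ha : a = 0
  · subst ha
    have : g * (b • f + c • g) = 0 := by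
      rw [← h]; simp only [smul_eq_C_mul, map_zero]; ring
    have := hi _ _ ((mul_eq_zero.1 this).resolve_left hg)
    exact ⟨rfl, this⟩
  exfalso
  by_cases hD : 0 ≤ b ^ 2 - 4 * a * c
  · set r := Real.sqrt (b ^ 2 - 4 * a * c) with hr
    have hr2 : r * r = b ^ 2 - 4 * a * c := Real.mul_self_sqrt hD
    have key : ((2 * a) • f + (b - r) • g) * ((2 * a) • f + (b + r) • g) = 0 := by
      have e : ((2 * a) • f + (b - r) • g) * ((2 * a) • f + (b + r) • g) =
        (4 * a) • (a • (f * f) + b • (f * g)) + (b ^ 2 - r * r) • (g * g) := by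
        simp only [smul_eq_C_mul, map_add, map_sub, map_mul, map_pow]
        have c2 : (C (2 : ℝ) : MP) = 2 := map_ofNat C 2
        have c4 : (C (4 : ℝ) : MP) = 4 := map_ofNat C 4
        rw [c2, c4]; ring
      rw [e, hr2]
      have : b ^ 2 - (b ^ 2 - 4 * a * c) = (4 * a) * c := by ring
      rw [this, mul_smul (4 * a) c, ← smul_add, h, smul_zero]
    rcases mul_eq_zero.1 key with k | k
    · have := (hi _ _ k).1; apply ha; linarith
    · have := (hi _ _ k).1; apply ha; linarith
  · push Not at hD
    apply hg
    apply MvPolynomial.funext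
    intro x
    have h' := congrArg (eval x) h
    simp [smul_eval] at h'
    rw [map_zero]
    by_contra hx
    have hx2 : 0 < eval x g * eval x g := mul_self_pos.2 hx
    have e : (2 * a * eval x f + b * eval x g) * (2 * a * eval x f + b * eval x g) =
        (b ^ 2 - 4 * a * c) * (eval x g * eval x g) := by linear_combination (4 * a) * h'
    have e1 := mul_self_nonneg (2 * a * eval x f + b * eval x g)
    have e2 := mul_pos (neg_pos.2 hD) hx2
    linarith

lemma finrank_sq {f g : MP} (hi : Indep f g) :
    Module.finrank ℝ (Submodule.span ℝ (Set.range ![f * f, f * g, g * g])) = 3 := by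
  rw [finrank_span_eq_card, Fintype.card_fin]
  rw [Fintype.linearIndependent_iff]
  intro r hr
  rw [Fin.sum_univ_three] at hr
  obtain ⟨h1, h2, h3⟩ := sq_indep hi _ _ _ hr
  intro i
  fin_cases i
  exacts [h1, h2, h3]

/-! ### Translation -/

lemma mk_gen {T : Set P2} (hgen : GenPos T) (p : Fin 8 → P2) (hp : Function.Injective p)
    (hT : Set.range p = T) : Gen (fun i => (p i).rep) := by
  have hcount : ∀ (l : MP) (s : Finset (Fin 8)), (∀ i ∈ s, eval (p i).rep l = 0) →
      ((s.card : ℕ) : ℕ∞) ≤ {P ∈ T | VanishAt l P}.encard := by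
    intro l s hs
    have : (s.card : ℕ∞) = (Set.image p (s : Set (Fin 8))).encard := by
      rw [hp.encard_image, Set.encard_coe_eq_coe_finsetCard]
    rw [this]
    apply Set.encard_le_encard
    rintro _ ⟨i, hi, rfl⟩
    exact ⟨hT ▸ Set.mem_range_self i, hs i hi⟩
  refine ⟨?_, ?_, ?_⟩
  · intro i j hij h0
    apply hij
    apply hp
    have hi0 := (p i).rep_nonzero
    have hj0 := (p j).rep_nonzero
    rw [← (p i).mk_rep, ← (p j).mk_rep, Projectivization.mk_eq_mk_iff']
    generalize (p i).rep = a at *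
    generalize (p j).rep = b at *
    have hbb := (dt_self_pos hj0).ne'
    have k0 : a 1 * b 2 - a 2 * b 1 = 0 := by simpa [cr] using congrFun h0 0
    have k1 : a 2 * b 0 - a 0 * b 2 = 0 := by simpa [cr] using congrFun h0 1
    have k2 : a 0 * b 1 - a 1 * b 0 = 0 := by simpa [cr] using congrFun h0 2
    refine ⟨dt a b / dt b b, ?_⟩
    ext k
    apply mul_left_cancel₀ hbb
    simp only [Pi.smul_apply, smul_eq_mul]
    field_simp
    simp only [dt]
    fin_cases k <;> simp
    · linear_combination (b 2) * k1 - (b 1) * k2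
    · linear_combination (b 0) * k2 - (b 2) * k0
    · linear_combination (b 1) * k0 - (b 0) * k1
  · intro l hl hl0 s hs
    have := (hcount l s hs).trans (hgen.1 l hl0 hl)
    exact_mod_cast this
  · intro l hl hl0 s hs
    have := (hcount l s hs).trans (hgen.2 l hl0 hl)
    exact_mod_cast this

theorem statement3 (T : Set P2) (hT8 : T.encard = 8) (hgen : GenPos T) :
    Module.finrank ℝ (Isub2 6 T) = 4 ∧ Module.finrank ℝ (IsqCubic T) = 3 := by
  obtain ⟨p, hp, hT⟩ : ∃ p : Fin 8 → P2, Function.Injective p ∧ Set.range p = T := by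
    have hfin : T.Finite := Set.finite_of_encard_eq_coe (k := 8) hT8
    have hc : hfin.toFinset.card = 8 := by
      rw [hfin.encard_eq_coe_toFinset_card] at hT8
      exact_mod_cast hT8
    let e := (Finset.equivFinOfCardEq hc).symm
    refine ⟨fun i => (e i).1, Subtype.val_injective.comp e.injective, ?_⟩
    ext x
    constructor
    · rintro ⟨i, rfl⟩
      exact hfin.mem_toFinset.1 (e i).2
    · intro hx
      exact ⟨e.symm ⟨x, hfin.mem_toFinset.2 hx⟩, by simp⟩
  have hv := mk_gen hgen p hp hT
  have hall : ∀ Q : P2 → Prop, (∀ P ∈ T, Q P) ↔ ∀ i, Q (p i) := by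
    intro Q
    rw [← hT, Set.forall_mem_range]
  constructor
  · have : Isub2 6 T = Sd 6 ⊓ LinearMap.ker (grL fun i => (p i).rep) := by
      ext F
      refine and_congr_right fun hF => ?_
      change (∀ P ∈ T, SingAt F P) ↔ F ∈ LinearMap.ker (grL fun i => (p i).rep)
      rw [hall, LinearMap.mem_ker, funext_iff]
      refine forall_congr' fun i => ?_
      constructor
      · intro h
        funext k
        exact h.2 k
      · intro h
        have h' : gr F (p i).rep = 0 := h
        refine ⟨?_, fun k => congrFun h' k⟩
        have e := euler hF (p i).rep
        rw [h'] at e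
        simpa [dt] using e
    rw [this]
    exact hv.finrank6
  · obtain ⟨f, hf, g, hg, hfv, hgv, hi, hsp⟩ := hv.exists_basis
    have hm : ∀ q, q ∈ Isub 3 T ↔ q ∈ Sd 3 ∧ ∀ i, eval (p i).rep q = 0 := by
      intro q
      refine and_congr_right fun _ => ?_
      change (∀ P ∈ T, VanishAt q P) ↔ _
      rw [hall]
      rfl
    have : IsqCubic T = Submodule.span ℝ (Set.range ![f * f, f * g, g * g]) := by
      have hk : ∀ k : Fin 3, ![f * f, f * g, g * g] k ∈
          Submodule.span ℝ (Set.range ![f * f, f * g, g * g]) := fun k =>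
        Submodule.subset_span ⟨k, rfl⟩
      apply le_antisymm
      · apply Submodule.span_le.2
        rintro _ ⟨q1, h1, q2, h2, rfl⟩
        obtain ⟨h1, h1'⟩ := (hm q1).1 h1
        obtain ⟨h2, h2'⟩ := (hm q2).1 h2
        obtain ⟨a, b, rfl⟩ := hsp q1 h1 h1'
        obtain ⟨c, d, rfl⟩ := hsp q2 h2 h2'
        have e : (a • f + b • g) * (c • f + d • g) =
            (a * c) • (f * f) + (a * d + b * c) • (f * g) + (b * d) • (g * g) := by
          simp only [smul_eq_C_mul, map_add, map_mul]; ring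
        rw [e]
        exact Submodule.add_mem _ (Submodule.add_mem _ (Submodule.smul_mem _ _ (hk 0))
          (Submodule.smul_mem _ _ (hk 1))) (Submodule.smul_mem _ _ (hk 2))
      · apply Submodule.span_le.2
        have mf := (hm f).2 ⟨hf, hfv⟩
        have mg := (hm g).2 ⟨hg, hgv⟩
        rintro _ ⟨k, rfl⟩
        apply Submodule.subset_span
        fin_cases k
        exacts [⟨f, mf, f, mf, rfl⟩, ⟨f, mf, g, mg, rfl⟩, ⟨g, mg, g, mg, rfl⟩]
    rw [this]
    exact finrank_sq hi

end
end

section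
/- Let g be a psd sextic form in ℝ[x₀,x₁,x₂] whose real projective zero set V_ℝ(g) is finite, and let S ⊂ V_ℝ(g) with |S| = 9. Then every nonzero cubic form f vanishing at every point of S is nonsingular at every point of S; that is, for each P ∈ S and each nonzero representative u ∈ ℝ³ of P, the gradient of f at u is nonzero. -/
open MvPolynomial

noncomputable section

theorem aux_deriv_zero (p : Polynomial ℝ) (h : ∀ x, 0 ≤ p.eval x) (t : ℝ) (ht : p.eval t = 0) :
    p.derivative.eval t = 0 := by
  have hm : IsLocalMin (fun x => p.eval x) t :=
    Filter.Eventually.of_forall (fun x => by simpa [ht] using h x)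
  have := hm.deriv_eq_zero
  simpa using this

theorem aux_two_le (p : Polynomial ℝ) (h0 : p ≠ 0) (h : ∀ x, 0 ≤ p.eval x) (t : ℝ)
    (ht : p.eval t = 0) : 2 ≤ p.rootMultiplicity t :=
  (Polynomial.one_lt_rootMultiplicity_iff_isRoot h0).2 ⟨ht, aux_deriv_zero p h t ht⟩

theorem aux_sum_mult (p : Polynomial ℝ) (s : Finset ℝ) (m : ℝ → ℕ)
    (hm : ∀ x ∈ s, m x ≤ p.rootMultiplicity x) : ∑ x ∈ s, m x ≤ p.natDegree := by
  calc ∑ x ∈ s, m x ≤ ∑ x ∈ s, p.roots.count x :=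
        Finset.sum_le_sum (fun x hx => by rw [Polynomial.count_roots]; exact hm x hx)
    _ ≤ p.roots.card := by
        rw [← Multiset.toFinset_sum_count_eq]
        calc ∑ x ∈ s, p.roots.count x ≤ ∑ x ∈ s ∪ p.roots.toFinset, p.roots.count x :=
              Finset.sum_le_sum_of_subset Finset.subset_union_left
          _ = _ := by
              symm
              apply Finset.sum_subset Finset.subset_union_right
              intro x _ hx
              exact Multiset.count_eq_zero.2 (fun h => hx (Multiset.mem_toFinset.2 h))
    _ ≤ _ := Polynomial.card_roots' p

/-- The affine core of the argument. -/
theorem aux_core (q c : Polynomial ℝ) (hq : q.natDegree ≤ 2) (hc : c.natDegree ≤ 3)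
    (a : ℕ → Polynomial ℝ) (ha : ∀ k, (a k).natDegree ≤ k) (G : ℝ → ℝ → ℝ)
    (hG : ∀ τ z, G τ z = (a 2).eval τ * z ^ 4 + (a 3).eval τ * z ^ 3 + (a 4).eval τ * z ^ 2
      + (a 5).eval τ * z + (a 6).eval τ)
    (hpos : ∀ τ z, 0 ≤ G τ z) (hfin : {p : ℝ × ℝ | G p.1 p.2 = 0}.Finite)
    (T : Finset (ℝ × ℝ)) (hT : T.card = 8) (hTG : ∀ p ∈ T, G p.1 p.2 = 0)
    (hTf : ∀ p ∈ T, q.eval p.1 * p.2 + c.eval p.1 = 0) (hne : q ≠ 0 ∨ c ≠ 0) : False := by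
  classical
  have hfib : ∀ τ, (T.filter (fun p => p.1 = τ)).card ≤ 2 := by
    intro τ
    set P : Polynomial ℝ := Polynomial.C ((a 2).eval τ) * Polynomial.X ^ 4 +
      Polynomial.C ((a 3).eval τ) * Polynomial.X ^ 3 + Polynomial.C ((a 4).eval τ) * Polynomial.X ^ 2
      + Polynomial.C ((a 5).eval τ) * Polynomial.X + Polynomial.C ((a 6).eval τ) with hP
    have hPe : ∀ z, P.eval z = G τ z := by intro z; rw [hG]; simp [hP]
    have hPd : P.natDegree ≤ 4 := by rw [hP]; compute_degree
    have hP0 : P ≠ 0 := by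
      intro h0
      apply Set.infinite_univ (α := ℝ)
      have : (Set.univ : Set ℝ) = (fun z => (τ, z)) ⁻¹' {p : ℝ × ℝ | G p.1 p.2 = 0} := by
        ext z; simp [← hPe, h0]
      rw [this]
      exact hfin.preimage (fun x _ y _ h => by simpa using h)
    have hcard : (T.filter (fun p => p.1 = τ)).card =
        ((T.filter (fun p => p.1 = τ)).image Prod.snd).card := by
      rw [Finset.card_image_of_injOn]
      intro x hx y hy h
      simp at hx hy
      exact Prod.ext (hx.2.trans hy.2.symm) h
    have := aux_sum_mult P ((T.filter (fun p => p.1 = τ)).image Prod.snd) (fun _ => 2) (by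
      intro x hx
      apply aux_two_le P hP0 (fun z => by rw [hPe]; exact hpos _ _)
      simp only [Finset.mem_image, Finset.mem_filter] at hx
      obtain ⟨p, ⟨hp, rfl⟩, rfl⟩ := hx
      rw [hPe]; exact hTG p hp)
    rw [Finset.sum_const, smul_eq_mul] at this
    omega
  have hsum : ∑ τ ∈ T.image Prod.fst, (T.filter (fun p => p.1 = τ)).card = 8 := by
    rw [← hT]; symm
    exact Finset.card_eq_sum_card_image _ _
  by_cases hq0 : q = 0
  · have hc0 : c ≠ 0 := by tauto
    have h1 := aux_sum_mult c (T.image Prod.fst) (fun _ => 1) (by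
      intro x hx
      obtain ⟨p, hp, rfl⟩ := Finset.mem_image.1 hx
      have := hTf p hp
      rw [hq0] at this
      simp at this
      exact (Polynomial.rootMultiplicity_pos hc0).2 this)
    have h2 := Finset.sum_le_sum (s := T.image Prod.fst) (fun τ _ => hfib τ)
    simp only [Finset.sum_const, smul_eq_mul] at h1 h2
    omega
  set H : Polynomial ℝ := a 2 * c ^ 4 - a 3 * c ^ 3 * q + a 4 * c ^ 2 * q ^ 2 - a 5 * c * q ^ 3
    + a 6 * q ^ 4 with hH
  have hHd : H.natDegree ≤ 14 := by
    have d := fun k => ha k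
    have d2 := d 2
    have d3 := d 3
    have d4 := d 4
    have d5 := d 5
    have d6 := d 6
    rw [hH]
    compute_degree
    omega
  have hHe : ∀ τ, q.eval τ ≠ 0 → H.eval τ = (q.eval τ) ^ 4 * G τ (- c.eval τ / q.eval τ) := by
    intro τ h
    rw [hG, hH]
    simp
    field_simp
    ring
  have hdense : Dense {τ | q.eval τ ≠ 0} := by
    have : {τ : ℝ | q.eval τ ≠ 0} = {τ | q.IsRoot τ}ᶜ := rfl
    rw [this]
    exact (Polynomial.finite_setOfPred_isRoot hq0).countable.dense_compl ℝ
  have hHpos : ∀ τ, 0 ≤ H.eval τ := by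
    have hcl : IsClosed {τ | 0 ≤ H.eval τ} := isClosed_le continuous_const H.continuous
    have hsub : {τ | q.eval τ ≠ 0} ⊆ {τ | 0 ≤ H.eval τ} := by
      intro τ h
      simp only [Set.mem_ofPred_eq] at h ⊢
      rw [hHe τ h]
      exact mul_nonneg (by positivity) (hpos _ _)
    intro τ
    have := hdense.closure_eq ▸ closure_minimal hsub hcl
    exact this (Set.mem_univ τ)
  by_cases hH0 : H = 0
  · have hinf : {τ | q.eval τ ≠ 0}.Infinite := 
      (Polynomial.finite_setOfPred_isRoot hq0).infinite_compl
    apply hinf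
    refine (hfin.image Prod.fst).subset ?_
    intro τ h
    refine ⟨(τ, - c.eval τ / q.eval τ), ?_, rfl⟩
    have := hHe τ h
    rw [hH0] at this
    simp only [Polynomial.eval_zero] at this
    have h4 : (q.eval τ) ^ 4 ≠ 0 := pow_ne_zero _ h
    simpa [h4] using this.symm
  · have := aux_sum_mult H (T.image Prod.fst) (fun τ => 2 * (T.filter (fun p => p.1 = τ)).card) (by
      intro τ hτ
      obtain ⟨p, hp, rfl⟩ := Finset.mem_image.1 hτ
      by_cases hqτ : q.eval p.1 = 0
      · have hcτ : c.eval p.1 = 0 := by have := hTf p hp; rw [hqτ] at this; simpa using this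
        have h4 : 4 ≤ H.rootMultiplicity p.1 := by
          rw [Polynomial.le_rootMultiplicity_iff hH0]
          obtain ⟨q', hq'⟩ := Polynomial.dvd_iff_isRoot.2 hqτ
          obtain ⟨c', hc'⟩ := Polynomial.dvd_iff_isRoot.2 hcτ
          rw [hH, hq', hc']
          refine ⟨a 2 * c' ^ 4 - a 3 * c' ^ 3 * q' + a 4 * c' ^ 2 * q' ^ 2 - a 5 * c' * q' ^ 3
            + a 6 * q' ^ 4, ?_⟩
          ring
        have := hfib p.1
        omega
      · have h1 : (T.filter (fun p' => p'.1 = p.1)).card ≤ 1 := by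
          rw [Finset.card_le_one]
          have key : ∀ x ∈ T.filter (fun p' => p'.1 = p.1), x = (p.1, - c.eval p.1 / q.eval p.1) := by
            intro x hx
            obtain ⟨hx1, hx2⟩ := Finset.mem_filter.1 hx
            have := hTf x hx1
            rw [hx2] at this
            refine Prod.ext hx2 ?_
            simp only
            field_simp
            linarith
          intro x hx y hy
          rw [key x hx, key y hy]
        have h2 : 2 ≤ H.rootMultiplicity p.1 := by
          apply aux_two_le H hH0 hHpos
          rw [hHe _ hqτ]
          have : - c.eval p.1 / q.eval p.1 = p.2 := by
            have := hTf p hp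
            field_simp
            linarith
          rw [this, hTG p hp, mul_zero]
        omega)
    rw [← Finset.mul_sum, hsum] at this
    omega

theorem aux_scale (n : ℕ) (φ : MvPolynomial (Fin 3) ℝ) (h : φ.IsHomogeneous n) (r : ℝ)
    (x : Fin 3 → ℝ) : eval (r • x) φ = r ^ n * eval x φ := by
  rw [eval_eq, eval_eq, Finset.mul_sum]
  refine Finset.sum_congr rfl (fun d hd => ?_)
  have hd' := h (mem_support_iff.1 hd)
  have : ∑ i ∈ d.support, d i = n := by
    rw [← hd', Finsupp.weight_apply, Finsupp.sum]; simp
  simp only [Pi.smul_apply, smul_eq_mul, mul_pow, Finset.prod_mul_distrib]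
  rw [Finset.prod_pow_eq_pow_sum, this]
  ring

/-- The generic expansion of a form near the vector `u`. -/
def auxExp (u A B : Fin 3 → ℝ) (φ : MvPolynomial (Fin 3) ℝ) : Polynomial (Polynomial ℝ) :=
  aeval (fun i => Polynomial.C (Polynomial.C (A i) * Polynomial.X + Polynomial.C (B i)) *
    Polynomial.X + Polynomial.C (Polynomial.C (u i))) φ

theorem auxExp_C (u A B : Fin 3 → ℝ) (r : ℝ) :
    auxExp u A B (C r) = Polynomial.C (Polynomial.C r) := by
  unfold auxExp
  rw [algHom_C]
  rfl

theorem auxExp_add (u A B : Fin 3 → ℝ) (p q : MvPolynomial (Fin 3) ℝ) :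
    auxExp u A B (p + q) = auxExp u A B p + auxExp u A B q := map_add _ _ _

theorem auxExp_mul_X (u A B : Fin 3 → ℝ) (p : MvPolynomial (Fin 3) ℝ) (i : Fin 3) :
    auxExp u A B (p * X i) = auxExp u A B p *
      (Polynomial.C (Polynomial.C (A i) * Polynomial.X + Polynomial.C (B i)) *
      Polynomial.X + Polynomial.C (Polynomial.C (u i))) := by
  unfold auxExp
  rw [map_mul, aeval_X]

theorem auxExp_coeff_natDegree (u A B : Fin 3 → ℝ) (φ : MvPolynomial (Fin 3) ℝ) :
    ∀ k, ((auxExp u A B φ).coeff k).natDegree ≤ k := by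
  induction φ using MvPolynomial.induction_on with
  | C r =>
    intro k
    rw [auxExp_C, Polynomial.coeff_C]
    split_ifs <;> simp
  | add p q hp hq =>
    intro k
    rw [auxExp_add, Polynomial.coeff_add]
    exact Polynomial.natDegree_add_le_of_degree_le (hp k) (hq k)
  | mul_X p i hp =>
    intro k
    rw [auxExp_mul_X, mul_add, ← mul_assoc, Polynomial.coeff_add, Polynomial.coeff_mul_C]
    apply Polynomial.natDegree_add_le_of_degree_le
    · cases k with
      | zero => simp
      | succ k =>
        rw [Polynomial.coeff_mul_X, Polynomial.coeff_mul_C]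
        refine Polynomial.natDegree_mul_le.trans ?_
        have := hp k
        have h2 : (Polynomial.C (A i) * Polynomial.X + Polynomial.C (B i)).natDegree ≤ 1 := by
          compute_degree
        omega
    · refine Polynomial.natDegree_mul_le.trans ?_
      have := hp k
      simpa using this

theorem auxExp_coeff_zero (u A B : Fin 3 → ℝ) (φ : MvPolynomial (Fin 3) ℝ) :
    (auxExp u A B φ).coeff 0 = Polynomial.C (eval u φ) := by
  induction φ using MvPolynomial.induction_on with
  | C r => rw [auxExp_C]; simp
  | add p q hp hq => rw [auxExp_add, Polynomial.coeff_add, hp, hq, map_add, map_add]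
  | mul_X p i hp =>
    rw [auxExp_mul_X, Polynomial.mul_coeff_zero, hp]; simp

theorem auxExp_coeff_one (u A B : Fin 3 → ℝ) (φ : MvPolynomial (Fin 3) ℝ) :
    (auxExp u A B φ).coeff 1 = ∑ i, Polynomial.C (eval u (pderiv i φ)) *
      (Polynomial.C (A i) * Polynomial.X + Polynomial.C (B i)) := by
  induction φ using MvPolynomial.induction_on with
  | C r =>
    rw [auxExp_C]
    simp
  | add p q hp hq =>
    rw [auxExp_add, Polynomial.coeff_add, hp, hq, ← Finset.sum_add_distrib]
    refine Finset.sum_congr rfl (fun i _ => ?_)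
    rw [map_add, map_add, map_add, add_mul]
  | mul_X p j hp =>
    have h0 := auxExp_coeff_zero u A B p
    rw [auxExp_mul_X, Polynomial.mul_coeff_one, h0, hp]
    generalize hl : (fun i => Polynomial.C (A i) * Polynomial.X + Polynomial.C (B i)) = l
    have hl' : ∀ i, Polynomial.C (A i) * Polynomial.X + Polynomial.C (B i) = l i :=
      fun i => congrFun hl i
    simp only [hl']
    have e1 : (Polynomial.C (l j) * Polynomial.X + Polynomial.C (Polynomial.C (u j))).coeff 1
        = l j := by
      rw [Polynomial.coeff_add, Polynomial.coeff_C_mul, Polynomial.coeff_X_one,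
        Polynomial.coeff_C_succ, mul_one, add_zero]
    have e0 : (Polynomial.C (l j) * Polynomial.X + Polynomial.C (Polynomial.C (u j))).coeff 0
        = Polynomial.C (u j) := by
      rw [Polynomial.coeff_add, Polynomial.coeff_C_mul, Polynomial.coeff_X_zero,
        Polynomial.coeff_C_zero, mul_zero, zero_add]
    have e2 : ∀ i, Polynomial.C (eval u (pderiv i (p * X j))) * l i =
        (if i = j then Polynomial.C (eval u p) * l j else 0) +
        Polynomial.C (eval u (pderiv i p)) * l i * Polynomial.C (u j) := by
      intro i
      rw [pderiv_mul, map_add, map_mul, map_mul, eval_X]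
      split_ifs with h
      · subst h
        rw [pderiv_X_self, map_one, map_add, map_mul, map_mul, map_one]
        ring
      · rw [pderiv_X_of_ne (Ne.symm h), map_zero, mul_zero, add_zero, map_mul]
        ring
    rw [e1, e0, Finset.sum_congr rfl (fun i _ => e2 i), Finset.sum_add_distrib, Finset.sum_mul]
    simp

theorem auxExp_natDegree (u A B : Fin 3 → ℝ) (φ : MvPolynomial (Fin 3) ℝ) (n : ℕ)
    (h : φ.IsHomogeneous n) : (auxExp u A B φ).natDegree ≤ n := by
  unfold auxExp
  rw [← aeval_map_algebraMap (Polynomial ℝ)]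
  have := aeval_natDegree_le (m := n) (n := 1) (map (algebraMap ℝ (Polynomial ℝ)) φ)
    ((h.map _).totalDegree_le)
    (fun i => Polynomial.C (Polynomial.C (A i) * Polynomial.X + Polynomial.C (B i)) *
    Polynomial.X + Polynomial.C (Polynomial.C (u i))) (by intro i; compute_degree)
  simpa using this

theorem auxExp_eval (u A B : Fin 3 → ℝ) (φ : MvPolynomial (Fin 3) ℝ) (τ w : ℝ) :
    ((auxExp u A B φ).map (Polynomial.evalRingHom τ)).eval w =
      eval (w • (τ • A + B) + u) φ := by
  induction φ using MvPolynomial.induction_on with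
  | C r => rw [auxExp_C]; simp
  | add p q hp hq => rw [auxExp_add, Polynomial.map_add, Polynomial.eval_add, hp, hq, map_add]
  | mul_X p i hp =>
    rw [auxExp_mul_X, Polynomial.map_mul, Polynomial.eval_mul, hp]; simp; left; ring

theorem auxExp_sum (u A B : Fin 3 → ℝ) (φ : MvPolynomial (Fin 3) ℝ) (n : ℕ)
    (h : φ.IsHomogeneous n) (τ w : ℝ) :
    eval (w • (τ • A + B) + u) φ =
      ∑ k ∈ Finset.range (n + 1), ((auxExp u A B φ).coeff k).eval τ * w ^ k := by
  rw [← auxExp_eval, Polynomial.eval_eq_sum_range' (n := n + 1)]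
  · simp
  · have := auxExp_natDegree u A B φ n h
    have h2 := Polynomial.natDegree_map_le (f := Polynomial.evalRingHom τ) (p := auxExp u A B φ)
    omega

theorem auxExp_sum' (u A B : Fin 3 → ℝ) (φ : MvPolynomial (Fin 3) ℝ) (n : ℕ)
    (h : φ.IsHomogeneous n) (τ z : ℝ) :
    eval (τ • A + B + z • u) φ =
      ∑ k ∈ Finset.range (n + 1), ((auxExp u A B φ).coeff k).eval τ * z ^ (n - k) := by
  set L : ℝ → ℝ := fun z => eval (τ • A + B + z • u) φ
  set R : ℝ → ℝ := fun z =>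
    ∑ k ∈ Finset.range (n + 1), ((auxExp u A B φ).coeff k).eval τ * z ^ (n - k)
  have hL : Continuous L := (MvPolynomial.continuous_eval φ).comp (by fun_prop)
  have hR : Continuous R := by fun_prop
  have hEq : Set.EqOn L R {0}ᶜ := by
    intro z hz
    have hz : z ≠ 0 := hz
    have e : τ • A + B + z • u = z • (z⁻¹ • (τ • A + B) + u) := by
      rw [smul_add, smul_smul, mul_inv_cancel₀ hz, one_smul]
    simp only [L, R]
    rw [e, aux_scale n φ h, auxExp_sum u A B φ n h, Finset.mul_sum]
    refine Finset.sum_congr rfl (fun k hk => ?_)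
    have hk : k ≤ n := by have := Finset.mem_range.1 hk; omega
    rw [pow_sub₀ z hz hk, inv_pow]
    ring
  have := Continuous.ext_on (dense_compl_singleton (0 : ℝ)) hL hR hEq
  exact congrFun this z

/-- Coordinates adapted to `u` and avoiding finitely many directions. -/
theorem aux_coords (u : Fin 3 → ℝ) (hu : u ≠ 0) {ι : Type} [Finite ι] (v : ι → Fin 3 → ℝ)
    (hv : ∀ i, v i ∉ Submodule.span ℝ {u}) :
    ∃ (l : (Fin 3 → ℝ) →ₗ[ℝ] ℝ) (A B : Fin 3 → ℝ), l u = 0 ∧ l A = 0 ∧ l B = 1 ∧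
      (∀ i, l (v i) ≠ 0) ∧ LinearIndependent ℝ ![A, B, u] := by
  classical
  have hex : ∃ e : Fin 3 → ℝ, e ∉ Submodule.span ℝ {u} := by
    by_contra! hcon
    have h1 : (⊤ : Submodule ℝ (Fin 3 → ℝ)) ≤ Submodule.span ℝ {u} := fun x _ => hcon x
    have h2 := Submodule.finrank_mono h1
    rw [finrank_top, finrank_span_singleton hu] at h2
    simp at h2
  obtain ⟨e, he⟩ := hex
  obtain ⟨m, hm⟩ := Module.exists_dual_forall_apply_ne_zero (K := ℝ)
    (M := (Fin 3 → ℝ) ⧸ Submodule.span ℝ {u})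
    (fun o : Option ι => (Submodule.span ℝ {u}).mkQ (o.elim e v)) (by
      rintro (_ | i)
      · simpa [Submodule.Quotient.mk_eq_zero] using he
      · simpa [Submodule.Quotient.mk_eq_zero] using hv i)
  set l : (Fin 3 → ℝ) →ₗ[ℝ] ℝ := m.comp (Submodule.span ℝ {u}).mkQ with hl
  have hlu : l u = 0 := by
    have : (Submodule.span ℝ {u}).mkQ u = 0 := by
      rw [Submodule.mkQ_apply, Submodule.Quotient.mk_eq_zero]
      exact Submodule.mem_span_singleton_self u
    rw [hl, LinearMap.comp_apply, this, map_zero]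
  have hle : l e ≠ 0 := hm none
  have hker : ∃ A : Fin 3 → ℝ, l A = 0 ∧ A ∉ Submodule.span ℝ {u} := by
    by_contra! hcon
    have h1 : LinearMap.ker l ≤ Submodule.span ℝ {u} := fun x hx => hcon x hx
    have h2 := Submodule.finrank_mono h1
    rw [finrank_span_singleton hu] at h2
    have h3 := LinearMap.finrank_range_add_finrank_ker l
    have h4 := Submodule.finrank_le (LinearMap.range l)
    simp at h3 h4
    omega
  obtain ⟨A, hA, hAu⟩ := hker
  have hB : l ((l e)⁻¹ • e) = 1 := by simp [hle]
  refine ⟨l, A, (l e)⁻¹ • e, hlu, hA, hB, fun i => hm (some i), ?_⟩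
  generalize (l e)⁻¹ • e = B at hB
  rw [Fintype.linearIndependent_iff]
  intro c hc
  simp only [Fin.sum_univ_three, Matrix.cons_val_zero, Matrix.cons_val_one, Matrix.cons_val] at hc
  have h1 : c 1 = 0 := by
    have := congrArg l hc
    simpa [hlu, hA, hB] using this
  rw [h1, zero_smul, add_zero] at hc
  have h0 : c 0 = 0 := by
    by_contra h
    apply hAu
    rw [Submodule.mem_span_singleton]
    refine ⟨-(c 0)⁻¹ * c 2, ?_⟩
    have : c 2 • u = - (c 0 • A) := by
      rw [eq_neg_iff_add_eq_zero, add_comm]; exact hc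
    rw [mul_smul, this, smul_neg, neg_smul, neg_neg, smul_smul, inv_mul_cancel₀ h, one_smul]
  rw [h0, zero_smul, zero_add] at hc
  have h2 : c 2 = 0 := by simpa [hu] using hc
  intro i
  fin_cases i <;> assumption

theorem aux_vanish (n : ℕ) (φ : MvPolynomial (Fin 3) ℝ) (h : φ.IsHomogeneous n)
    (x : Fin 3 → ℝ) (hx : x ≠ 0) : VanishAt φ (Projectivization.mk ℝ x hx) ↔ eval x φ = 0 := by
  obtain ⟨a, ha⟩ := Projectivization.exists_smul_eq_mk_rep ℝ x hx
  unfold VanishAt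
  rw [← ha, Units.smul_def, aux_scale n φ h]
  simp


theorem statement5 (g : MvPolynomial (Fin 3) ℝ) (hg6 : g.IsHomogeneous 6) (hpsd : Psd g)
    (hfin : (VR g).Finite) (S : Set P2) (hSsub : S ⊆ VR g) (hS9 : S.encard = 9)
    (f : MvPolynomial (Fin 3) ℝ) (hf3 : f.IsHomogeneous 3) (hf0 : f ≠ 0)
    (hfvan : ∀ P ∈ S, VanishAt f P) :
    ∀ P ∈ S, ∀ (u : Fin 3 → ℝ) (hu : u ≠ 0), Projectivization.mk ℝ u hu = P →
      ∃ i, eval u (pderiv i f) ≠ 0 := by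
  intro P hPS u hu hP
  by_contra! hsing
  have hfu : eval u f = 0 := (aux_vanish 3 f hf3 u hu).1 (by rw [hP]; exact hfvan P hPS)
  have hgu : eval u g = 0 := (aux_vanish 6 g hg6 u hu).1 (by rw [hP]; exact hSsub hPS)
  have hSfin : (S \ {P}).Finite := (hfin.subset hSsub).subset Set.sdiff_subset
  have : Finite ↥(S \ {P}) := hSfin
  obtain ⟨l, A, B, hlu, hlA, hlB, hlv, hind⟩ := aux_coords u hu
    (fun Q : ↥(S \ {P}) => (Q : P2).rep) (by
      rintro ⟨Q, hQS, hQP⟩ hmem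
      apply hQP
      rw [Submodule.mem_span_singleton] at hmem
      obtain ⟨r, hr⟩ := hmem
      change Q = P
      rw [← hP, ← Q.mk_rep, Projectivization.mk_eq_mk_iff']
      exact ⟨r, hr⟩)
  have hlp : ∀ τ z : ℝ, l (τ • A + B + z • u) = 1 := by
    intro τ z; simp [hlA, hlB, hlu]
  have hp0 : ∀ p : ℝ × ℝ, p.1 • A + B + p.2 • u ≠ 0 := by
    intro p h
    have := hlp p.1 p.2
    rw [h, map_zero] at this
    exact zero_ne_one this
  have hli := Fintype.linearIndependent_iff.1 hind
  simp only [Fin.sum_univ_three, Matrix.cons_val_zero, Matrix.cons_val_one, Matrix.cons_val] at hli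
  -- every vector is a combination
  have hspan : ∀ x : Fin 3 → ℝ, ∃ s z : ℝ, x = s • A + l x • B + z • u := by
    intro x
    have htop := hind.span_eq_top_of_card_eq_finrank (by simp)
    have hx : x ∈ Submodule.span ℝ (Set.range ![A, B, u]) := by rw [htop]; trivial
    rw [Submodule.mem_span_range_iff_exists_fun] at hx
    obtain ⟨c, hc⟩ := hx
    simp only [Fin.sum_univ_three, Matrix.cons_val_zero, Matrix.cons_val_one,
      Matrix.cons_val] at hc
    have hlx : l x = c 1 := by rw [← hc]; simp [hlA, hlB, hlu]
    exact ⟨c 0, c 2, by rw [hlx, hc]⟩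
  have hscale : ∀ x : Fin 3 → ℝ, l x ≠ 0 → ∃ τ z : ℝ, x = l x • (τ • A + B + z • u) := by
    intro x hx
    obtain ⟨s, z, h⟩ := hspan x
    refine ⟨(l x)⁻¹ * s, (l x)⁻¹ * z, ?_⟩
    rw [smul_add, smul_add, smul_smul, smul_smul, mul_inv_cancel_left₀ hx,
      mul_inv_cancel_left₀ hx]
    exact h
  let φ : ℝ × ℝ → P2 := fun p => Projectivization.mk ℝ _ (hp0 p)
  have hφ : Function.Injective φ := by
    intro p p' h
    simp only [φ] at h
    rw [Projectivization.mk_eq_mk_iff'] at h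
    obtain ⟨r, hr⟩ := h
    have hr1 : r = 1 := by
      have := congrArg l hr
      rw [map_smul, hlp, hlp] at this
      simpa using this
    rw [hr1, one_smul] at hr
    have hz := hli ![p'.1 - p.1, 0, p'.2 - p.2] (by
      simp only [Matrix.cons_val_zero, Matrix.cons_val_one, Matrix.cons_val]
      rw [sub_smul, sub_smul, zero_smul, add_zero]
      have : p'.1 • A + p'.2 • u - (p.1 • A + p.2 • u) = 0 := by
        rw [sub_eq_zero]
        have h' := congrArg (fun y => y - B) hr
        rw [show p'.1 • A + p'.2 • u = p'.1 • A + B + p'.2 • u - B by abel,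
          show p.1 • A + p.2 • u = p.1 • A + B + p.2 • u - B by abel]
        exact h'
      rw [← this]; abel)
    have z0 := hz 0
    have z2 := hz 2
    simp at z0 z2
    exact Prod.ext (by linarith) (by linarith)
  have hrange : S \ {P} ⊆ Set.range φ := by
    intro Q hQ
    have h := hlv ⟨Q, hQ⟩
    simp only at h
    obtain ⟨τ, z, hx⟩ := hscale _ h
    refine ⟨(τ, z), ?_⟩
    simp only [φ]
    conv_rhs => rw [← Q.mk_rep]
    symm
    rw [Projectivization.mk_eq_mk_iff']
    exact ⟨_, hx.symm⟩
  have hTfin : (φ ⁻¹' (S \ {P})).Finite := hSfin.preimage hφ.injOn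
  have hTcard : hTfin.toFinset.card = 8 := by
    have h1 := Set.encard_preimage_of_injective_subset_range hφ hrange
    rw [Set.encard_sdiff_singleton_of_mem hPS, hS9, hTfin.encard_eq_coe_toFinset_card] at h1
    have h2 : ((9 : ℕ∞) - 1) = ((8 : ℕ) : ℕ∞) := rfl
    rw [h2] at h1
    exact_mod_cast h1
  -- expansions
  set b := fun k => (auxExp u A B f).coeff k with hb
  set a := fun k => (auxExp u A B g).coeff k with ha
  have hb0 : b 0 = 0 := by simp only [hb]; rw [auxExp_coeff_zero, hfu, map_zero]
  have hb1 : b 1 = 0 := by simp only [hb]; rw [auxExp_coeff_one]; simp [hsing]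
  have ha0 : a 0 = 0 := by simp only [ha]; rw [auxExp_coeff_zero, hgu, map_zero]
  have ha1 : a 1 = 0 := by
    apply Polynomial.funext
    intro τ
    have h1 := aux_deriv_zero ((auxExp u A B g).map (Polynomial.evalRingHom τ))
      (fun w => by rw [auxExp_eval]; exact hpsd _) 0 (by rw [auxExp_eval]; simpa using hgu)
    rw [← Polynomial.coeff_zero_eq_eval_zero, Polynomial.coeff_derivative,
      Polynomial.coeff_map] at h1
    simpa [ha] using h1
  have hfe : ∀ τ z : ℝ, eval (τ • A + B + z • u) f = (b 2).eval τ * z + (b 3).eval τ := by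
    intro τ z
    rw [auxExp_sum' u A B f 3 hf3]
    change ∑ k ∈ Finset.range 4, (b k).eval τ * z ^ (3 - k) = _
    simp [Finset.sum_range_succ, hb0, hb1]
  have hge : ∀ τ z : ℝ, eval (τ • A + B + z • u) g = (a 2).eval τ * z ^ 4 +
      (a 3).eval τ * z ^ 3 + (a 4).eval τ * z ^ 2 + (a 5).eval τ * z + (a 6).eval τ := by
    intro τ z
    rw [auxExp_sum' u A B g 6 hg6]
    change ∑ k ∈ Finset.range 7, (a k).eval τ * z ^ (6 - k) = _
    simp [Finset.sum_range_succ, ha0, ha1]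
  refine aux_core (b 2) (b 3) (auxExp_coeff_natDegree u A B f 2)
    (auxExp_coeff_natDegree u A B f 3) a (auxExp_coeff_natDegree u A B g)
    (fun τ z => eval (τ • A + B + z • u) g) hge (fun τ z => hpsd _) ?_ hTfin.toFinset hTcard
    ?_ ?_ ?_
  · refine (hfin.preimage (f := φ) hφ.injOn).subset ?_
    intro p hp
    exact (aux_vanish 6 g hg6 _ (hp0 p)).2 hp
  · intro p hp
    rw [Set.Finite.mem_toFinset] at hp
    exact (aux_vanish 6 g hg6 _ (hp0 p)).1 (hSsub hp.1)
  · intro p hp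
    rw [Set.Finite.mem_toFinset] at hp
    rw [← hfe]
    exact (aux_vanish 3 f hf3 _ (hp0 p)).1 (hfvan _ hp.1)
  · by_contra! hcon
    obtain ⟨h2, h3⟩ := hcon
    set L : MvPolynomial (Fin 3) ℝ := ∑ i, C (l (Pi.single i 1)) * X i with hL
    have hLe : ∀ x, eval x L = l x := by
      intro x
      conv_rhs => rw [pi_eq_sum_univ' x, map_sum]
      simp only [hL, map_sum, map_mul, eval_C, eval_X, map_smul, smul_eq_mul]
      refine Finset.sum_congr rfl (fun i _ => ?_)
      rw [mul_comm]
    have hL0 : L ≠ 0 := by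
      intro h
      have := hLe B
      rw [h, hlB, map_zero] at this
      exact zero_ne_one this
    have : f * L = 0 := by
      apply MvPolynomial.funext
      intro x
      rw [map_mul, hLe, map_zero]
      by_cases hx : l x = 0
      · rw [hx, mul_zero]
      · obtain ⟨τ, z, h⟩ := hscale x hx
        rw [h, aux_scale 3 f hf3, hfe, h2, h3]
        simp
    rcases mul_eq_zero.1 this with h | h
    · exact hf0 h
    · exact hL0 h

end
end
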